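/- arXiv:1708.09258 — 2 statements merged into one kernel-verified Lean document; each statement's English description precedes it below -/
import Mathlib

section
/- Let 0 < s < 1/2 and let f be a smooth compactly supported function on ℝ^{2n+1}. Then for every p ∈ ℝ^{2n+1} the integral ∫_{ℝ^{2n+1}} (f(p) − f(q)) |q^{−1}·p|^{−(Q+2s)} dq converges absolutely, and lim_{ρ→0⁺} ρ^{−2s} ( f(p) − C₁(n,s) ρ^{2s} (f ∗ φ_{s,ρ})(p) ) = C₁(n,s) ∫_{ℝ^{2n+1}} (f(p) − f(q)) |q^{−1}·p|^{−(Q+2s)} dq. -/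
noncomputable section
open MeasureTheory Real Set Topology Filter
open scoped ENNReal NNReal

/-- The Heisenberg group `ℍⁿ = ℝⁿ × ℝⁿ × ℝ ≅ ℝ^{2n+1}`, points `p = (x, y, t)`. -/
abbrev Heis (n : ℕ) := EuclideanSpace ℝ (Fin n) × EuclideanSpace ℝ (Fin n) × ℝ

namespace Heis

variable {n : ℕ}

/-- The Heisenberg group law
`(x,y,t)·(x',y',t') = (x+x', y+y', t+t' + (1/2)∑ (y_j x'_j − x_j y'_j))`. -/
def hmul (p q : Heis n) : Heis n :=
  (p.1 + q.1, p.2.1 + q.2.1,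
    p.2.2 + q.2.2 + 1 / 2 * ∑ j, (p.2.1 j * q.1 j - p.1 j * q.2.1 j))

/-- The Heisenberg group inverse `p⁻¹ = (-x, -y, -t)`. -/
def hinv (p : Heis n) : Heis n := (-p.1, -p.2.1, -p.2.2)

/-- Convolution on `ℍⁿ`: `(f ∗ g)(p) = ∫ f(p·q⁻¹) g(q) dq`. -/
def hconv (f g : Heis n → ℝ) (p : Heis n) : ℝ :=
  ∫ q : Heis n, f (hmul p (hinv q)) * g q

/-- The homogeneous norm `|(v,t)| = (|v|⁴ + 16 t²)^{1/4}`. -/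
def hnorm (p : Heis n) : ℝ :=
  ((‖p.1‖ ^ 2 + ‖p.2.1‖ ^ 2) ^ 2 + 16 * p.2.2 ^ 2) ^ ((1 : ℝ) / 4)

/-- The kernel `φ_{s,ρ}(v,t) = ((ρ²+|v|²)² + 16t²)^{-(n+1+s)/2}`. -/
def phiK (n : ℕ) (s ρ : ℝ) (p : Heis n) : ℝ :=
  ((ρ ^ 2 + (‖p.1‖ ^ 2 + ‖p.2.1‖ ^ 2)) ^ 2 + 16 * p.2.2 ^ 2) ^
    (-(((n : ℝ) + 1 + s) / 2))

/-- `C₁(n,s) = (4/π^{n+1/2})·Γ(n+s)Γ((n+1+s)/2)/(Γ(s)Γ((n+s)/2))`. -/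
def C1 (n : ℕ) (s : ℝ) : ℝ :=
  4 / π ^ ((n : ℝ) + 1 / 2) *
    (Gamma ((n : ℝ) + s) * Gamma (((n : ℝ) + 1 + s) / 2)) /
    (Gamma s * Gamma (((n : ℝ) + s) / 2))

/-- The left-invariant vector field `X_j = ∂_{x_j} + (1/2) y_j ∂_t`. -/
def vfX (j : Fin n) (F : Heis n → ℝ) (p : Heis n) : ℝ :=
  fderiv ℝ F p (EuclideanSpace.single j 1, 0, 0) +
    1 / 2 * p.2.1 j * fderiv ℝ F p (0, 0, 1)

/-- The left-invariant vector field `X_{n+j} = ∂_{y_j} − (1/2) x_j ∂_t`. -/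
def vfY (j : Fin n) (F : Heis n → ℝ) (p : Heis n) : ℝ :=
  fderiv ℝ F p (0, EuclideanSpace.single j 1, 0) -
    1 / 2 * p.1 j * fderiv ℝ F p (0, 0, 1)

/-- The vector field `∂_t`. -/
def vfT (F : Heis n → ℝ) (p : Heis n) : ℝ := fderiv ℝ F p (0, 0, 1)

/-- The sublaplacian `𝓛 = −∑_{j=1}^{2n} X_j²`. -/
def subL (F : Heis n → ℝ) (p : Heis n) : ℝ :=
  -(∑ j, (vfX j (vfX j F) p + vfY j (vfY j F) p))

/-- The extension operator
`𝕃u = −𝓛u + ∂_ρ²u + ((1−2s)/ρ)∂_ρu + (1/4)ρ²∂_t²u`, for `u = u(p, ρ)`. -/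
def extOp (s : ℝ) (u : Heis n → ℝ → ℝ) (p : Heis n) (ρ : ℝ) : ℝ :=
  -subL (fun q => u q ρ) p + deriv (deriv (u p)) ρ +
    (1 - 2 * s) / ρ * deriv (u p) ρ +
    1 / 4 * ρ ^ 2 * vfT (fun q => vfT (fun q' => u q' ρ) q) p

/-- `|∇u|² = ∑_{j=1}^{2n} (X_j u)² + (1/4)(∂_t u)² + (∂_ρ u)²` for `u = u(p, ρ)`. -/
def gradSq (u : Heis n → ℝ → ℝ) (p : Heis n) (ρ : ℝ) : ℝ :=
  (∑ j, ((vfX j (fun q => u q ρ) p) ^ 2 + (vfY j (fun q => u q ρ) p) ^ 2)) +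
    1 / 4 * (vfT (fun q => u q ρ) p) ^ 2 + (deriv (u p) ρ) ^ 2

end Heis

open Heis

theorem lintegral_rpow_mul_exp_neg_mul_Ioi {a r : ℝ} (ha : 0 < a) (hr : 0 < r) :
    ∫⁻ u in Ioi (0 : ℝ), ENNReal.ofReal (u ^ (a - 1) * exp (-(r * u))) =
      ENNReal.ofReal (r ^ (-a) * Gamma a) := by
  have h := integral_rpow_mul_exp_neg_mul_Ioi ha hr
  have hG := Gamma_pos_of_pos ha
  rw [← ofReal_integral_eq_lintegral_ofReal, h, one_div, inv_rpow hr.le, rpow_neg hr.le]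
  · exact .of_integral_ne_zero (by rw [h]; positivity)
  · filter_upwards [self_mem_ae_restrict measurableSet_Ioi] with u hu
    have : 0 < u := hu
    positivity

section EuclideanIntegral

variable {V : Type*} [NormedAddCommGroup V] [InnerProductSpace ℝ V] [FiniteDimensional ℝ V]
  [MeasurableSpace V] [BorelSpace V]

theorem lintegral_exp_neg_mul_sq_norm {u : ℝ} (hu : 0 < u) :
    ∫⁻ v : V, ENNReal.ofReal (exp (-u * ‖v‖ ^ 2)) =
      ENNReal.ofReal ((π / u) ^ (Module.finrank ℝ V / 2 : ℝ)) := by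
  have h := GaussianFourier.integral_rexp_neg_mul_sq_norm (V := V) hu
  rw [← h, ofReal_integral_eq_lintegral_ofReal]
  · exact .of_integral_ne_zero (by rw [h]; positivity)
  · exact ae_of_all _ fun v => (exp_pos _).le

/-- The Gamma-function evaluation of `∫ (A + c‖v‖²)^{-b} dv`. -/
theorem lintegral_rpow_add_mul_sq_norm {A c b : ℝ} (hA : 0 < A) (hc : 0 < c)
    (hb : (Module.finrank ℝ V / 2 : ℝ) < b) :
    ∫⁻ v : V, ENNReal.ofReal ((A + c * ‖v‖ ^ 2) ^ (-b)) =
      ENNReal.ofReal ((π / c) ^ (Module.finrank ℝ V / 2 : ℝ) *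
        (Gamma (b - Module.finrank ℝ V / 2) / Gamma b) *
        A ^ (-(b - Module.finrank ℝ V / 2))) := by
  set d : ℝ := Module.finrank ℝ V / 2 with hd
  have hd0 : 0 ≤ d := by positivity
  have hb0 : 0 < b := hd0.trans_lt hb
  have hG := Gamma_pos_of_pos hb0
  have h1 (v : V) : ENNReal.ofReal ((A + c * ‖v‖ ^ 2) ^ (-b)) =
      ENNReal.ofReal (Gamma b)⁻¹ * ∫⁻ u in Ioi (0 : ℝ),
        ENNReal.ofReal (u ^ (b - 1) * exp (-((A + c * ‖v‖ ^ 2) * u))) := by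
    have hr : 0 < A + c * ‖v‖ ^ 2 := by positivity
    rw [lintegral_rpow_mul_exp_neg_mul_Ioi hb0 hr, ← ENNReal.ofReal_mul (by positivity)]
    congr 1
    field_simp
  have h2 (u : ℝ) (hu : u ∈ Ioi (0 : ℝ)) :
      ∫⁻ v : V, ENNReal.ofReal (u ^ (b - 1) * exp (-((A + c * ‖v‖ ^ 2) * u))) =
        ENNReal.ofReal ((π / c) ^ d) *
          ENNReal.ofReal (u ^ (b - d - 1) * exp (-(A * u))) := by
    have hu : 0 < u := hu
    have h3 (v : V) : ENNReal.ofReal (u ^ (b - 1) * exp (-((A + c * ‖v‖ ^ 2) * u))) =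
        ENNReal.ofReal (u ^ (b - 1) * exp (-(A * u))) *
          ENNReal.ofReal (exp (-(c * u) * ‖v‖ ^ 2)) := by
      rw [← ENNReal.ofReal_mul (by positivity), mul_assoc, ← Real.exp_add]
      ring_nf
    simp_rw [h3]
    rw [lintegral_const_mul _ (by fun_prop), lintegral_exp_neg_mul_sq_norm (by positivity),
      ← ENNReal.ofReal_mul (by positivity), ← ENNReal.ofReal_mul (by positivity), ← hd,
      ← div_div, div_rpow (by positivity) hu.le, show b - d - 1 = (b - 1) - d by ring,
      rpow_sub hu (b - 1) d]
    congr 1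
    field_simp
  simp_rw [h1]
  rw [lintegral_const_mul' _ _ ENNReal.ofReal_ne_top, lintegral_lintegral_swap,
    setLIntegral_congr_fun measurableSet_Ioi h2, lintegral_const_mul' _ _ ENNReal.ofReal_ne_top,
    lintegral_rpow_mul_exp_neg_mul_Ioi (by linarith) hA, ← ENNReal.ofReal_mul (by positivity),
    ← ENNReal.ofReal_mul (by positivity)]
  · congr 1
    field_simp
  · unfold Function.uncurry
    exact Measurable.aemeasurable (by fun_prop)

end EuclideanIntegral

namespace Heis

variable {n : ℕ}

theorem measurable_phiK (s : ℝ) : Measurable fun x : ℝ × Heis n => phiK n s x.1 x.2 := by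
  unfold phiK
  fun_prop

theorem C1_pos (n : ℕ) {s : ℝ} (hs : 0 < s) : 0 < C1 n s := by
  have h1 : 0 < Gamma ((n : ℝ) + s) := Gamma_pos_of_pos (by positivity)
  have h2 : 0 < Gamma (((n : ℝ) + 1 + s) / 2) := Gamma_pos_of_pos (by positivity)
  have h3 : 0 < Gamma s := Gamma_pos_of_pos hs
  have h4 : 0 < Gamma (((n : ℝ) + s) / 2) := Gamma_pos_of_pos (by positivity)
  unfold C1
  positivity

theorem lintegral_phiK (n : ℕ) {s ρ : ℝ} (hs : 0 < s) (hρ : 0 < ρ) :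
    ∫⁻ q : Heis n, ENNReal.ofReal (phiK n s ρ q) =
      ENNReal.ofReal ((C1 n s)⁻¹ * ρ ^ (-(2 * s))) := by
  have hm : Measurable fun q : Heis n => ENNReal.ofReal (phiK n s ρ q) := by
    unfold phiK
    fun_prop
  have g1 : 0 < Gamma ((n : ℝ) + s) := Gamma_pos_of_pos (by positivity)
  have g2 : 0 < Gamma (((n : ℝ) + 1 + s) / 2) := Gamma_pos_of_pos (by positivity)
  have g3 : 0 < Gamma s := Gamma_pos_of_pos hs
  have g4 : 0 < Gamma (((n : ℝ) + s) / 2) := Gamma_pos_of_pos (by positivity)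
  have g5 : 0 < Gamma ((n : ℝ) / 2 + s) := Gamma_pos_of_pos (by positivity)
  have ht (x y : EuclideanSpace ℝ (Fin n)) :
      ∫⁻ t : ℝ, ENNReal.ofReal (phiK n s ρ (x, y, t)) =
        ENNReal.ofReal ((π / 16) ^ (1 / 2 : ℝ) *
          (Gamma (((n : ℝ) + s) / 2) / Gamma (((n : ℝ) + 1 + s) / 2))) *
        ENNReal.ofReal (((ρ ^ 2 + 1 * ‖x‖ ^ 2) + 1 * ‖y‖ ^ 2) ^ (-((n : ℝ) + s))) := by
    have hA : 0 < ρ ^ 2 + (‖x‖ ^ 2 + ‖y‖ ^ 2) := by positivity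
    have := lintegral_rpow_add_mul_sq_norm (V := ℝ) (b := ((n : ℝ) + 1 + s) / 2)
      (A := (ρ ^ 2 + (‖x‖ ^ 2 + ‖y‖ ^ 2)) ^ 2) (c := 16) (by positivity) (by norm_num)
      (by simp only [Module.finrank_self, Nat.cast_one]; linarith [(Nat.cast_nonneg n : (0 : ℝ) ≤ n)])
    simp only [Module.finrank_self, Nat.cast_one, Real.norm_eq_abs, sq_abs,
      show ((n : ℝ) + 1 + s) / 2 - 1 / 2 = ((n : ℝ) + s) / 2 by ring] at this
    simp only [phiK]
    rw [this, ← ENNReal.ofReal_mul (by positivity), ← rpow_natCast, ← rpow_mul hA.le]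
    congr 3
    · ring
    · push_cast; ring
  have hy (x : EuclideanSpace ℝ (Fin n)) :
      ∫⁻ y : EuclideanSpace ℝ (Fin n),
        ENNReal.ofReal (((ρ ^ 2 + 1 * ‖x‖ ^ 2) + 1 * ‖y‖ ^ 2) ^ (-((n : ℝ) + s))) =
        ENNReal.ofReal (π ^ ((n : ℝ) / 2) * (Gamma ((n : ℝ) / 2 + s) / Gamma ((n : ℝ) + s))) *
          ENNReal.ofReal ((ρ ^ 2 + 1 * ‖x‖ ^ 2) ^ (-((n : ℝ) / 2 + s))) := by
    rw [lintegral_rpow_add_mul_sq_norm (by positivity) one_pos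
      (by rw [finrank_euclideanSpace_fin]; linarith [(Nat.cast_nonneg n : (0 : ℝ) ≤ n)]),
      ← ENNReal.ofReal_mul (by positivity)]
    simp only [finrank_euclideanSpace_fin, div_one,
      show (n : ℝ) + s - n / 2 = n / 2 + s by ring]
  have hx : ∫⁻ x : EuclideanSpace ℝ (Fin n),
        ENNReal.ofReal ((ρ ^ 2 + 1 * ‖x‖ ^ 2) ^ (-((n : ℝ) / 2 + s))) =
        ENNReal.ofReal (π ^ ((n : ℝ) / 2) * (Gamma s / Gamma ((n : ℝ) / 2 + s)) *
          ρ ^ (-(2 * s))) := by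
    rw [lintegral_rpow_add_mul_sq_norm (by positivity) one_pos
      (by rw [finrank_euclideanSpace_fin]; linarith [(Nat.cast_nonneg n : (0 : ℝ) ≤ n)])]
    simp only [finrank_euclideanSpace_fin, div_one, add_sub_cancel_left]
    rw [← rpow_natCast ρ 2, ← rpow_mul hρ.le]
    congr 3
    push_cast; ring
  have key : ∫⁻ q : Heis n, ENNReal.ofReal (phiK n s ρ q) =
      ∫⁻ x : EuclideanSpace ℝ (Fin n), ∫⁻ y : EuclideanSpace ℝ (Fin n), ∫⁻ t : ℝ,
        ENNReal.ofReal (phiK n s ρ (x, y, t)) := by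
    rw [Measure.volume_eq_prod, lintegral_prod _ hm.aemeasurable]
    congr 1 with x
    rw [Measure.volume_eq_prod, lintegral_prod]
    exact (hm.comp measurable_prodMk_left).aemeasurable
  simp_rw [key, ht]
  simp_rw [lintegral_const_mul' _ _ ENNReal.ofReal_ne_top, hy]
  simp_rw [lintegral_const_mul' _ _ ENNReal.ofReal_ne_top, hx]
  rw [← ENNReal.ofReal_mul (by positivity), ← ENNReal.ofReal_mul (by positivity)]
  congr 1
  have h16 : (π / 16) ^ (1 / 2 : ℝ) = π ^ (1 / 2 : ℝ) / 4 := by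
    rw [div_rpow pi_pos.le (by norm_num), show (16 : ℝ) = 4 ^ (2 : ℝ) by norm_num,
      ← rpow_mul (by norm_num)]
    norm_num
  have hpi : π ^ ((n : ℝ) + 1 / 2) = π ^ ((n : ℝ) / 2) * π ^ ((n : ℝ) / 2) * π ^ (1 / 2 : ℝ) := by
    rw [← rpow_add pi_pos, ← rpow_add pi_pos]
    ring_nf
  rw [C1, h16, hpi]
  field_simp

theorem phiK_nonneg (n : ℕ) (s ρ : ℝ) (q : Heis n) : 0 ≤ phiK n s ρ q := by
  unfold phiK
  positivity

theorem measurable_phiK_right (s ρ : ℝ) : Measurable (phiK n s ρ) := by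
  unfold phiK
  fun_prop

theorem integrable_phiK (n : ℕ) {s ρ : ℝ} (hs : 0 < s) (hρ : 0 < ρ) :
    Integrable (phiK n s ρ) := by
  refine ⟨(measurable_phiK_right s ρ).aestronglyMeasurable, ?_⟩
  rw [hasFiniteIntegral_iff_ofReal (ae_of_all _ (phiK_nonneg n s ρ)), lintegral_phiK n hs hρ]
  exact ENNReal.ofReal_lt_top

theorem integral_phiK (n : ℕ) {s ρ : ℝ} (hs : 0 < s) (hρ : 0 < ρ) :
    ∫ q : Heis n, phiK n s ρ q = (C1 n s)⁻¹ * ρ ^ (-(2 * s)) := by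
  have := C1_pos n hs
  rw [integral_eq_lintegral_of_nonneg_ae (ae_of_all _ (phiK_nonneg n s ρ))
    (measurable_phiK_right s ρ).aestronglyMeasurable, lintegral_phiK n hs hρ,
    ENNReal.toReal_ofReal (by positivity)]

theorem hnorm_nonneg (q : Heis n) : 0 ≤ hnorm q := by
  unfold hnorm
  positivity

theorem hnorm_pow_four (q : Heis n) :
    hnorm q ^ 4 = (‖q.1‖ ^ 2 + ‖q.2.1‖ ^ 2) ^ 2 + 16 * q.2.2 ^ 2 := by
  rw [hnorm, ← rpow_natCast, ← rpow_mul (by positivity)]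
  norm_num

theorem hnorm_rpow_eq_phiK_zero (s : ℝ) (q : Heis n) :
    hnorm q ^ (-(2 * (n : ℝ) + 2 + 2 * s)) = phiK n s 0 q := by
  rw [hnorm, phiK, ← rpow_mul (by positivity)]
  congr 1
  · ring
  · ring

theorem measurable_hnorm : Measurable (hnorm (n := n)) := by
  unfold hnorm
  fun_prop

theorem hnorm_pos {q : Heis n} (hq : q ≠ 0) : 0 < hnorm q := by
  refine (hnorm_nonneg q).lt_of_ne' fun h => hq ?_
  have h4 := hnorm_pow_four q
  rw [h] at h4
  have h1 : ‖q.1‖ = 0 := by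
    by_contra h1
    have : 0 < ‖q.1‖ := (norm_nonneg _).lt_of_ne' h1
    have : 0 < (‖q.1‖ ^ 2 + ‖q.2.1‖ ^ 2) ^ 2 + 16 * q.2.2 ^ 2 := by positivity
    linarith
  have h2 : ‖q.2.1‖ = 0 := by
    by_contra h2
    have : 0 < ‖q.2.1‖ := (norm_nonneg _).lt_of_ne' h2
    have : 0 < (‖q.1‖ ^ 2 + ‖q.2.1‖ ^ 2) ^ 2 + 16 * q.2.2 ^ 2 := by positivity
    linarith
  have h3 : q.2.2 = 0 := by
    rw [h1, h2] at h4
    nlinarith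
  exact Prod.ext (norm_eq_zero.1 h1) (Prod.ext (norm_eq_zero.1 h2) h3)

theorem phiK_zero_le_mul_phiK {s ρ : ℝ} (hs : 0 < s) (hρ : 0 < ρ) {q : Heis n}
    (hq : ρ ≤ hnorm q) :
    phiK n s 0 q ≤ 4 ^ (((n : ℝ) + 1 + s) / 2) * phiK n s ρ q := by
  have h4 := hnorm_pow_four q
  have hρ4 : ρ ^ 4 ≤ hnorm q ^ 4 := by gcongr
  have ha : (0 : ℝ) ≤ ((n : ℝ) + 1 + s) / 2 := by positivity
  simp only [phiK]
  set a := ((n : ℝ) + 1 + s) / 2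
  set E := ‖q.1‖ ^ 2 + ‖q.2.1‖ ^ 2
  have hE : 0 ≤ E := by positivity
  have hle : (ρ ^ 2 + E) ^ 2 + 16 * q.2.2 ^ 2 ≤ 4 * ((0 ^ 2 + E) ^ 2 + 16 * q.2.2 ^ 2) := by
    nlinarith [sq_nonneg (ρ ^ 2 - E), sq_nonneg q.2.2]
  have h := rpow_le_rpow_of_nonpos (by positivity) hle (neg_nonpos.2 ha)
  rw [mul_rpow (by norm_num) (by positivity)] at h
  calc ((0 ^ 2 + E) ^ 2 + 16 * q.2.2 ^ 2) ^ (-a)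
      = 4 ^ a * (4 ^ (-a) * ((0 ^ 2 + E) ^ 2 + 16 * q.2.2 ^ 2) ^ (-a)) := by
        rw [← mul_assoc, ← rpow_add (by norm_num)]
        simp
    _ ≤ _ := by gcongr

theorem phiK_le_phiK_zero {s : ℝ} (hs : 0 < s) (ρ : ℝ) {q : Heis n} (hq : q ≠ 0) :
    phiK n s ρ q ≤ phiK n s 0 q := by
  have h0 := pow_pos (hnorm_pos hq) 4
  rw [hnorm_pow_four] at h0
  refine rpow_le_rpow_of_nonpos (by simpa using h0) ?_
    (neg_nonpos.2 (by positivity))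
  have : (0 : ℝ) ^ 2 ≤ ρ ^ 2 := by simpa using sq_nonneg ρ
  exact add_le_add_left (pow_le_pow_left₀ (by positivity) (add_le_add_left this _) 2) _

theorem tendsto_phiK_zero (s : ℝ) {q : Heis n} (hq : q ≠ 0) :
    Tendsto (fun ρ => phiK n s ρ q) (𝓝 0) (𝓝 (phiK n s 0 q)) := by
  have h0 := pow_pos (hnorm_pos hq) 4
  rw [hnorm_pow_four] at h0
  refine ContinuousAt.rpow_const (by fun_prop) (Or.inl ?_)
  simpa using h0.ne'

theorem integrable_min_one_hnorm_mul_phiK_zero (n : ℕ) {s : ℝ} (hs0 : 0 < s) (hs1 : s < 1 / 2) :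
    Integrable fun q : Heis n => min 1 (hnorm q) * phiK n s 0 q := by
  refine ⟨((measurable_const.min measurable_hnorm).mul
    (measurable_phiK_right s 0)).aestronglyMeasurable, ?_⟩
  rw [hasFiniteIntegral_iff_ofReal
    (ae_of_all _ fun q => mul_nonneg (le_min zero_le_one (hnorm_nonneg q)) (phiK_nonneg n s 0 q))]
  set K : ℝ := 4 ^ (((n : ℝ) + 1 + s) / 2) with hK
  have hK0 : 0 ≤ K := by positivity
  have hle (q : Heis n) : ENNReal.ofReal (min 1 (hnorm q) * phiK n s 0 q) ≤
      ∫⁻ ρ in Ioc (0 : ℝ) 1, ENNReal.ofReal K * ENNReal.ofReal (phiK n s ρ q) := by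
    calc ENNReal.ofReal (min 1 (hnorm q) * phiK n s 0 q)
        = ∫⁻ ρ in Ioc (0 : ℝ) (min 1 (hnorm q)), ENNReal.ofReal (phiK n s 0 q) := by
          rw [setLIntegral_const, Real.volume_Ioc, sub_zero, mul_comm,
            ENNReal.ofReal_mul (phiK_nonneg n s 0 q)]
      _ ≤ ∫⁻ ρ in Ioc (0 : ℝ) (min 1 (hnorm q)),
            ENNReal.ofReal K * ENNReal.ofReal (phiK n s ρ q) := by
          refine setLIntegral_mono' measurableSet_Ioc fun ρ hρ => ?_
          rw [← ENNReal.ofReal_mul hK0]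
          exact ENNReal.ofReal_le_ofReal
            (phiK_zero_le_mul_phiK hs0 hρ.1 (hρ.2.trans (min_le_right _ _)))
      _ ≤ _ := lintegral_mono_set (Ioc_subset_Ioc_right (min_le_left _ _))
  refine (lintegral_mono hle).trans_lt ?_
  have hm : Measurable (Function.uncurry fun (q : Heis n) (ρ : ℝ) =>
      ENNReal.ofReal K * ENNReal.ofReal (phiK n s ρ q)) :=
    (((measurable_phiK s).comp measurable_swap).ennreal_ofReal).const_mul _
  have hi : IntegrableOn (fun ρ : ℝ => (C1 n s)⁻¹ * ρ ^ (-(2 * s))) (Ioc 0 1) := by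
    have := intervalIntegral.intervalIntegrable_rpow' (a := 0) (b := 1) (r := -(2 * s))
      (by linarith)
    rw [intervalIntegrable_iff_integrableOn_Ioc_of_le zero_le_one] at this
    exact this.const_mul _
  rw [lintegral_lintegral_swap hm.aemeasurable,
    setLIntegral_congr_fun (g := fun ρ => ENNReal.ofReal K *
      ENNReal.ofReal ((C1 n s)⁻¹ * ρ ^ (-(2 * s)))) measurableSet_Ioc,
    lintegral_const_mul' _ _ ENNReal.ofReal_ne_top]
  · exact ENNReal.mul_lt_top ENNReal.ofReal_lt_top hi.lintegral_lt_top
  · intro ρ hρ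
    simp only
    rw [lintegral_const_mul' _ _ ENNReal.ofReal_ne_top, lintegral_phiK n hs0 hρ.1]

theorem hmul_hinv_hmul_hinv (p q : Heis n) : hmul (hinv (hmul p (hinv q))) p = q := by
  refine Prod.ext ?_ (Prod.ext ?_ ?_)
  · simp [hmul, hinv]
  · simp [hmul, hinv]
  · simp only [hmul, hinv, PiLp.neg_apply, PiLp.add_apply, neg_add_rev, neg_neg]
    have h : ∑ j, ((q.2.1 j + -p.2.1 j) * p.1 j - (q.1 j + -p.1 j) * p.2.1 j) =
        ∑ j, (p.2.1 j * -q.1 j - p.1 j * -q.2.1 j) :=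
      Finset.sum_congr rfl fun j _ => by ring
    rw [h]
    ring

theorem measurePreserving_hmul_hinv (p : Heis n) :
    MeasurePreserving fun q : Heis n => hmul p (hinv q) := by
  have h (x : EuclideanSpace ℝ (Fin n)) : MeasurePreserving
      (fun r : EuclideanSpace ℝ (Fin n) × ℝ => (p.2.1 - r.1,
        p.2.2 + 1 / 2 * ∑ j, (p.1 j * r.1 j - p.2.1 j * x j) - r.2)) := by
    refine (Measure.measurePreserving_sub_left volume p.2.1).skew_product
      (g := fun y t => p.2.2 + 1 / 2 * ∑ j, (p.1 j * y j - p.2.1 j * x j) - t) ?_ ?_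
    · unfold Function.uncurry
      fun_prop
    · exact ae_of_all _ fun y => (Measure.measurePreserving_sub_left volume _).map_eq
  have := (Measure.measurePreserving_sub_left (volume : Measure (EuclideanSpace ℝ (Fin n))) p.1).skew_product
    (g := fun x (r : EuclideanSpace ℝ (Fin n) × ℝ) => (p.2.1 - r.1,
        p.2.2 + 1 / 2 * ∑ j, (p.1 j * r.1 j - p.2.1 j * x j) - r.2))
    (μc := volume) (μd := volume)
    (by unfold Function.uncurry; fun_prop) (ae_of_all _ fun x => (h x).map_eq)
  convert this using 2 with q
  · simp only [hmul, hinv, PiLp.neg_apply, sub_eq_add_neg, mul_neg, neg_neg]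
    congr 2
    simp_rw [add_comm (-(p.2.1 _ * _))]
    ring
  · rfl
  · rfl

theorem exists_abs_sub_hmul_hinv_le {f : Heis n → ℝ} (hf : ContDiff ℝ (⊤ : ℕ∞) f)
    (hfc : HasCompactSupport f) (p : Heis n) :
    ∃ C : ℝ, ∀ q : Heis n, |f p - f (hmul p (hinv q))| ≤ C * min 1 (hnorm q) := by
  obtain ⟨M, hM⟩ := hfc.exists_bound_of_continuous hf.continuous
  obtain ⟨L, hL⟩ := hf.lipschitzWith_of_hasCompactSupport hfc (by simp)
  set D : ℝ := 1 + (‖p.1‖ + ‖p.2.1‖) / 2 with hD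
  have hD1 : 1 ≤ D := by rw [hD]; linarith [norm_nonneg p.1, norm_nonneg p.2.1]
  refine ⟨max (2 * M) (L * D), fun q => ?_⟩
  have hN := hnorm_nonneg q
  have h4 := hnorm_pow_four q
  rcases le_total 1 (hnorm q) with h | h
  · rw [min_eq_left h, mul_one]
    refine (abs_sub _ _).trans (le_trans ?_ (le_max_left _ _))
    have h1 := hM p
    have h2 := hM (hmul p (hinv q))
    rw [Real.norm_eq_abs] at h1 h2
    linarith
  · rw [min_eq_right h]
    have hx : ‖q.1‖ ≤ hnorm q := by
      refine (pow_le_pow_iff_left₀ (norm_nonneg _) hN (n := 4) (by norm_num)).1 ?_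
      rw [h4]
      nlinarith [sq_nonneg q.2.2, sq_nonneg (‖q.2.1‖), sq_nonneg (‖q.1‖ * ‖q.2.1‖),
        sq_nonneg (‖q.2.1‖ ^ 2)]
    have hy : ‖q.2.1‖ ≤ hnorm q := by
      refine (pow_le_pow_iff_left₀ (norm_nonneg _) hN (n := 4) (by norm_num)).1 ?_
      rw [h4]
      nlinarith [sq_nonneg q.2.2, sq_nonneg (‖q.2.1‖), sq_nonneg (‖q.1‖ * ‖q.2.1‖),
        sq_nonneg (‖q.1‖ ^ 2)]
    have ht : |q.2.2| ≤ hnorm q := by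
      refine le_trans (abs_le_of_sq_le_sq (b := hnorm q ^ 2) ?_ (by positivity))
        (pow_le_of_le_one hN h two_ne_zero)
      nlinarith [sq_nonneg q.2.2, sq_nonneg (‖q.1‖ ^ 2 + ‖q.2.1‖ ^ 2)]
    have hsum : ∑ j, (p.2.1 j * (hinv q).1 j - p.1 j * (hinv q).2.1 j) =
        inner ℝ p.1 q.2.1 - inner ℝ p.2.1 q.1 := by
      simp only [hinv, PiLp.inner_apply, ← Finset.sum_sub_distrib]
      refine Finset.sum_congr rfl fun j _ => ?_
      simp
      ring
    have hdist : dist p (hmul p (hinv q)) ≤ D * hnorm q := by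
      have hDN : hnorm q ≤ D * hnorm q := le_mul_of_one_le_left hN hD1
      have i1 := (abs_real_inner_le_norm p.1 q.2.1).trans
        (mul_le_mul_of_nonneg_left hy (norm_nonneg _))
      have i2 := (abs_real_inner_le_norm p.2.1 q.1).trans
        (mul_le_mul_of_nonneg_left hx (norm_nonneg _))
      refine max_le ?_ (max_le ?_ ?_)
      · simpa [dist_eq_norm, hmul, hinv] using hx.trans hDN
      · simpa [dist_eq_norm, hmul, hinv] using hy.trans hDN
      · rw [Real.dist_eq, hmul, hsum]
        simp only [hinv]
        rw [abs_le] at *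
        constructor <;> nlinarith
    have := hL.dist_le_mul p (hmul p (hinv q))
    rw [Real.dist_eq] at this
    calc |f p - f (hmul p (hinv q))| ≤ L * (D * hnorm q) :=
          this.trans (mul_le_mul_of_nonneg_left hdist L.2)
      _ = L * D * hnorm q := by ring
      _ ≤ _ := mul_le_mul_of_nonneg_right (le_max_right _ _) hN

end Heis

theorem stmt_10 (n : ℕ) (hn : 1 ≤ n) (s : ℝ) (hs0 : 0 < s) (hs1 : s < 1 / 2)
    (f : Heis n → ℝ) (hf : ContDiff ℝ (⊤ : ℕ∞) f) (hfc : HasCompactSupport f)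
    (p : Heis n) :
    Integrable (fun q : Heis n =>
      (f p - f q) * hnorm (hmul (hinv q) p) ^ (-(2 * (n : ℝ) + 2 + 2 * s))) ∧
    Tendsto
      (fun ρ : ℝ =>
        ρ ^ (-(2 * s)) * (f p - C1 n s * ρ ^ (2 * s) * hconv f (phiK n s ρ) p))
      (𝓝[>] 0)
      (𝓝 (C1 n s * ∫ q : Heis n,
        (f p - f q) * hnorm (hmul (hinv q) p) ^ (-(2 * (n : ℝ) + 2 + 2 * s)))) := by
  have hC1 := C1_pos n hs0
  have hT := measurePreserving_hmul_hinv p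
  obtain ⟨C, hC⟩ := exists_abs_sub_hmul_hinv_le hf hfc p
  have hmf : Measurable fun q : Heis n => f (hmul p (hinv q)) :=
    hf.continuous.measurable.comp hT.measurable
  set F : Heis n → ℝ := fun q =>
    (f p - f q) * hnorm (hmul (hinv q) p) ^ (-(2 * (n : ℝ) + 2 + 2 * s)) with hF
  have hFm : Measurable F := by
    refine (hf.continuous.measurable.const_sub _).mul (Measurable.pow_const ?_ _)
    refine measurable_hnorm.comp ?_
    unfold hmul hinv
    fun_prop
  have hcomp : (F ∘ fun q => hmul p (hinv q)) =
      fun q => (f p - f (hmul p (hinv q))) * phiK n s 0 q := by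
    ext q
    simp only [hF, Function.comp_apply, hmul_hinv_hmul_hinv, hnorm_rpow_eq_phiK_zero]
  have hbound : Integrable fun q : Heis n => C * (min 1 (hnorm q) * phiK n s 0 q) :=
    (integrable_min_one_hnorm_mul_phiK_zero n hs0 hs1).const_mul C
  have hint : Integrable fun q => (f p - f (hmul p (hinv q))) * phiK n s 0 q := by
    refine hbound.mono' ((hmf.const_sub _).mul (measurable_phiK_right s 0)).aestronglyMeasurable
      (ae_of_all _ fun q => ?_)
    rw [norm_mul, Real.norm_eq_abs, Real.norm_of_nonneg (phiK_nonneg n s 0 q), ← mul_assoc]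
    exact mul_le_mul_of_nonneg_right (hC q) (phiK_nonneg n s 0 q)
  have hFint : Integrable F :=
    (hT.integrable_comp hFm.aestronglyMeasurable).1 (hcomp ▸ hint)
  refine ⟨hFint, ?_⟩
  have hFeq : ∫ q, F q = ∫ q, (f p - f (hmul p (hinv q))) * phiK n s 0 q := by
    rw [← hcomp]
    conv_lhs => rw [← hT.map_eq]
    exact integral_map hT.measurable.aemeasurable hFm.aestronglyMeasurable
  rw [hFeq]
  have hlim : Tendsto (fun ρ : ℝ => ∫ q : Heis n, (f p - f (hmul p (hinv q))) * phiK n s ρ q)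
      (𝓝[>] 0) (𝓝 (∫ q : Heis n, (f p - f (hmul p (hinv q))) * phiK n s 0 q)) := by
    have h0 (q : Heis n) (hq : q = 0) : f p - f (hmul p (hinv q)) = 0 := by
      subst hq
      simp [hmul, hinv]
    refine tendsto_integral_filter_of_dominated_convergence _
      (Eventually.of_forall fun ρ =>
        ((hmf.const_sub _).mul (measurable_phiK_right s ρ)).aestronglyMeasurable)
      (Eventually.of_forall fun ρ => ae_of_all _ fun q => ?_) hint.norm
      (ae_of_all _ fun q => ?_)
    · by_cases hq : q = 0
      · simp [h0 q hq]
      · rw [norm_mul, norm_mul, Real.norm_of_nonneg (phiK_nonneg n s 0 q),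
          Real.norm_of_nonneg (phiK_nonneg n s ρ q)]
        exact mul_le_mul_of_nonneg_left (phiK_le_phiK_zero hs0 ρ hq) (norm_nonneg _)
    · by_cases hq : q = 0
      · simp [h0 q hq]
      · exact ((tendsto_phiK_zero s hq).mono_left nhdsWithin_le_nhds).const_mul _
  refine (hlim.const_mul (C1 n s)).congr' ?_
  filter_upwards [self_mem_nhdsWithin] with ρ hρ
  have hρ : 0 < ρ := hρ
  obtain ⟨M, hM⟩ := hfc.exists_bound_of_continuous hf.continuous
  have hconv_int : Integrable fun q : Heis n => f (hmul p (hinv q)) * phiK n s ρ q :=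
    (integrable_phiK n hs0 hρ).bdd_mul hmf.aestronglyMeasurable (ae_of_all _ fun q => hM _)
  have hsplit : ∫ q : Heis n, (f p - f (hmul p (hinv q))) * phiK n s ρ q =
      f p * ((C1 n s)⁻¹ * ρ ^ (-(2 * s))) - hconv f (phiK n s ρ) p := by
    simp_rw [sub_mul]
    rw [integral_sub ((integrable_phiK n hs0 hρ).const_mul _) hconv_int, integral_const_mul,
      integral_phiK n hs0 hρ, hconv]
  rw [hsplit, rpow_neg hρ.le]
  have : 0 < ρ ^ (2 * s) := by positivity
  field_simp
end
end

section
/- Let 0 < s < 1/2, δ > 0, and let f be a real-valued smooth compactly supported function on ℝ^{2n+1}. Then (A_{n,s}/2) ∫_{ℝ^{2n+1}} ∫_{ℝ^{2n+1}} (f(p) − f(q))² |q^{−1}·p|^{−(Q+2s)} dq dp ≥ 4^{2s} (Γ((n+1+s)/2)/Γ((n+1−s)/2))² δ^{2s} ∫_{ℝ^{2n+1}} f((v,t))² ((δ²+|v|²)² + 16t²)^{−s} dv dt, where A_{n,s} = (4^{1+s} s / π^{n+1/2}) · Γ(n+s) Γ((n+1+s)/2) / (Γ((n+s)/2) Γ(1−s)).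 -/
noncomputable section
open MeasureTheory Real Set Topology Filter
open scoped ENNReal NNReal

open Heis

namespace Heis

open scoped RealInnerProductSpace

section Plane

/-- The squared Euclidean norm `|x|² + |y|²` on `ℝⁿ × ℝⁿ`. -/
def normSqV {n : ℕ} (v : EuclideanSpace ℝ (Fin n) × EuclideanSpace ℝ (Fin n)) : ℝ :=
  ‖v.1‖ ^ 2 + ‖v.2‖ ^ 2

variable {n : ℕ}

local notation "V" => EuclideanSpace ℝ (Fin n) × EuclideanSpace ℝ (Fin n)

lemma normSqV_nonneg (v : V) : 0 ≤ normSqV v := by unfold normSqV; positivity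

lemma normSqV_pos {v : V} (hv : v ≠ 0) : 0 < normSqV v := by
  refine (normSqV_nonneg v).lt_of_ne' fun h => hv ?_
  have h1 : ‖v.1‖ ^ 2 = 0 := by unfold normSqV at h; nlinarith [sq_nonneg ‖v.1‖, sq_nonneg ‖v.2‖]
  have h2 : ‖v.2‖ ^ 2 = 0 := by unfold normSqV at h; nlinarith [sq_nonneg ‖v.1‖, sq_nonneg ‖v.2‖]
  ext1
  · simpa using h1
  · simpa using h2

lemma normSqV_smul (c : ℝ) (v : V) : normSqV (c • v) = c ^ 2 * normSqV v := by
  simp only [normSqV, Prod.smul_fst, Prod.smul_snd, norm_smul, mul_pow, Real.norm_eq_abs, sq_abs]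
  ring

@[fun_prop]
lemma continuous_normSqV : Continuous (normSqV (n := n)) := by unfold normSqV; fun_prop

lemma abs_det_of_comp_self_eq_smul (L : V →L[ℝ] V) {k : ℝ} (hk : 0 ≤ k)
    (hL : ∀ v, L (L v) = k • v) : |L.det| = k ^ n := by
  have h1 : (L : V →ₗ[ℝ] V) ∘ₗ (L : V →ₗ[ℝ] V) = k • LinearMap.id := by
    ext v <;> simp [hL]
  have h2 : L.det * L.det = (k ^ n) ^ 2 := by
    have := congrArg LinearMap.det h1
    rw [LinearMap.det_comp, LinearMap.det_smul, LinearMap.det_id] at this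
    rw [ContinuousLinearMap.det, this]
    simp only [Module.finrank_prod, finrank_euclideanSpace, Fintype.card_fin, mul_one]
    ring
  rw [← abs_of_nonneg (pow_nonneg hk n), ← sq_eq_sq_iff_abs_eq_abs, ← h2, sq]

/-- Complex multiplication by `α + iβ` on `ℝⁿ × ℝⁿ ≅ ℂⁿ`. -/
def cmul (α β : ℝ) : V →L[ℝ] V :=
  ContinuousLinearMap.prod
    (α • ContinuousLinearMap.fst ℝ _ _ - β • ContinuousLinearMap.snd ℝ _ _)
    (α • ContinuousLinearMap.snd ℝ _ _ + β • ContinuousLinearMap.fst ℝ _ _)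

lemma cmul_apply (α β : ℝ) (v : V) :
    cmul α β v = (α • v.1 - β • v.2, α • v.2 + β • v.1) := rfl

lemma cmul_cmul (α β γ δ : ℝ) (v : V) :
    cmul α β (cmul γ δ v) = cmul (α * γ - β * δ) (α * δ + β * γ) v := by
  simp only [cmul_apply]
  ext1 <;> simp only <;> module

lemma cmul_zero_right (α : ℝ) (v : V) : cmul α 0 v = α • v := by
  simp [cmul_apply, Prod.smul_def]

lemma normSqV_cmul (α β : ℝ) (v : V) : normSqV (cmul α β v) = (α ^ 2 + β ^ 2) * normSqV v := by
  simp only [normSqV, cmul_apply, norm_sub_sq_real, norm_add_sq_real, inner_smul_left,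
    inner_smul_right, norm_smul, mul_pow, Real.norm_eq_abs, sq_abs, real_inner_comm v.1 v.2]
  simp
  ring

/-- Complex conjugation `(x, y) ↦ (x, -y)` on `ℝⁿ × ℝⁿ ≅ ℂⁿ`. -/
def conjV : V →L[ℝ] V :=
  (ContinuousLinearMap.fst ℝ _ _).prod (-ContinuousLinearMap.snd ℝ _ _)

lemma abs_det_cmul (α β : ℝ) : |(cmul (n := n) α β).det| = (α ^ 2 + β ^ 2) ^ n := by
  have h1 : |((conjV (n := n)).comp (cmul (n := n) α β)).det| = (α ^ 2 + β ^ 2) ^ n := by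
    refine abs_det_of_comp_self_eq_smul _ (by positivity) fun v => ?_
    simp only [conjV, cmul_apply, ContinuousLinearMap.comp_apply, ContinuousLinearMap.prod_apply,
      ContinuousLinearMap.coe_fst', ContinuousLinearMap.coe_snd', neg_apply]
    ext1 <;> simp only [Prod.smul_fst, Prod.smul_snd] <;> module
  have h2 : |(conjV (n := n)).det| = 1 ^ n :=
    abs_det_of_comp_self_eq_smul _ zero_le_one fun v => by
      simp [conjV]
  have h3 : ((conjV (n := n)).comp (cmul (n := n) α β)).det
      = (conjV (n := n)).det * (cmul (n := n) α β).det := LinearMap.det_comp _ _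
  rw [h3, abs_mul, h2, one_pow, one_mul] at h1
  exact h1

instance instIsAddHaarMeasurePlane : (volume : Measure V).IsAddHaarMeasure :=
  inferInstanceAs (Measure.IsAddHaarMeasure
    ((volume : Measure (EuclideanSpace ℝ (Fin n))).prod volume))

lemma lintegral_comp_cmul {α β : ℝ} (h : 0 < α ^ 2 + β ^ 2) (F : V → ℝ≥0∞) :
    ∫⁻ v, F v = ∫⁻ v, ENNReal.ofReal ((α ^ 2 + β ^ 2) ^ n) * F (cmul α β v) := by
  have hinv : ∀ v : V, cmul (α / (α ^ 2 + β ^ 2)) (-β / (α ^ 2 + β ^ 2)) (cmul α β v) = v := by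
    intro v
    rw [cmul_cmul]
    have h1 : α / (α ^ 2 + β ^ 2) * α - -β / (α ^ 2 + β ^ 2) * β = 1 := by field_simp; ring
    have h2 : α / (α ^ 2 + β ^ 2) * β + -β / (α ^ 2 + β ^ 2) * α = 0 := by field_simp; ring
    rw [h1, h2, cmul_zero_right, one_smul]
  have hinv' : ∀ v : V, cmul α β (cmul (α / (α ^ 2 + β ^ 2)) (-β / (α ^ 2 + β ^ 2)) v) = v := by
    intro v
    rw [cmul_cmul]
    have h1 : α * (α / (α ^ 2 + β ^ 2)) - β * (-β / (α ^ 2 + β ^ 2)) = 1 := by field_simp; ring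
    have h2 : α * (-β / (α ^ 2 + β ^ 2)) + β * (α / (α ^ 2 + β ^ 2)) = 0 := by field_simp; ring
    rw [h1, h2, cmul_zero_right, one_smul]
  have key := lintegral_image_eq_lintegral_abs_det_fderiv_mul (volume : Measure V)
    MeasurableSet.univ (f := cmul α β) (f' := fun _ => cmul α β)
    (fun x _ => (cmul α β).hasFDerivAt.hasFDerivWithinAt)
    (Function.LeftInverse.injective hinv).injOn F
  rw [image_univ, (Function.RightInverse.surjective hinv').range_eq] at key
  simpa [abs_det_cmul] using key

/-- The derivative of the Euclidean inversion `v ↦ v / |v|²`. -/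
def inversionDeriv (v : V) : V →L[ℝ] V :=
  (normSqV v)⁻¹ • ContinuousLinearMap.id ℝ V -
    (2 * ((normSqV v) ^ 2)⁻¹) • ((innerSL ℝ v.1).comp (ContinuousLinearMap.fst ℝ _ _) +
      (innerSL ℝ v.2).comp (ContinuousLinearMap.snd ℝ _ _)).smulRight v

lemma hasFDerivAt_inversion {v : V} (hv : v ≠ 0) :
    HasFDerivAt (fun v : V => (normSqV v)⁻¹ • v) (inversionDeriv v) v := by
  have h1 : HasFDerivAt (normSqV (n := n))
      ((2 : ℝ) • ((innerSL ℝ v.1).comp (ContinuousLinearMap.fst ℝ _ _) +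
      (innerSL ℝ v.2).comp (ContinuousLinearMap.snd ℝ _ _))) v := by
    have h1 := (hasFDerivAt_fst (𝕜 := ℝ) (p := v)).norm_sq
    have h2 := (hasFDerivAt_snd (𝕜 := ℝ) (p := v)).norm_sq
    exact (h1.add h2).congr_fderiv (by ext w <;> simp)
  have h2 := ((hasDerivAt_inv (normSqV_pos hv).ne').comp_hasFDerivAt v h1).smul (hasFDerivAt_id v)
  refine h2.congr_fderiv ?_
  ext w <;> simp [inversionDeriv] <;> ring

lemma abs_det_inversionDeriv {v : V} (hv : v ≠ 0) :
    |(inversionDeriv v).det| = ((normSqV v ^ 2)⁻¹) ^ n := by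
  have hp := normSqV_pos hv
  refine abs_det_of_comp_self_eq_smul _ (by positivity) fun w => ?_
  have e : ∀ w, inversionDeriv v w =
      (normSqV v)⁻¹ • w - (2 * ((normSqV v) ^ 2)⁻¹ * (⟪v.1, w.1⟫ + ⟪v.2, w.2⟫)) • v := by
    intro w
    simp [inversionDeriv, smul_smul]
  rw [e, e]
  have h1 : ⟪v.1, v.1⟫ + ⟪v.2, v.2⟫ = normSqV v := by simp [normSqV]
  set N := normSqV v
  set b := ⟪v.1, w.1⟫ + ⟪v.2, w.2⟫ with hb
  have h2 : ⟪v.1, (N⁻¹ • w - (2 * (N ^ 2)⁻¹ * b) • v).1⟫ +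
      ⟪v.2, (N⁻¹ • w - (2 * (N ^ 2)⁻¹ * b) • v).2⟫ = - N⁻¹ * b := by
    simp only [Prod.fst_sub, Prod.snd_sub, Prod.smul_fst, Prod.smul_snd, inner_sub_right,
      inner_smul_right]
    have : N⁻¹ * ⟪v.1, w.1⟫ - 2 * (N ^ 2)⁻¹ * b * ⟪v.1, v.1⟫ +
        (N⁻¹ * ⟪v.2, w.2⟫ - 2 * (N ^ 2)⁻¹ * b * ⟪v.2, v.2⟫)
        = N⁻¹ * b - 2 * (N ^ 2)⁻¹ * b * N := by rw [hb, ← h1]; ring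
    rw [this]
    field_simp
    ring
  rw [h2, smul_sub, smul_smul, smul_smul, sub_sub, ← add_smul]
  have h3 : N⁻¹ * (2 * (N ^ 2)⁻¹ * b) + 2 * (N ^ 2)⁻¹ * (-N⁻¹ * b) = 0 := by ring
  rw [h3, zero_smul, sub_zero]
  congr 1
  field_simp

lemma lintegral_comp_inversion (hn : 1 ≤ n) (F : V → ℝ≥0∞) :
    ∫⁻ v, F v = ∫⁻ v, ENNReal.ofReal (((normSqV v ^ 2)⁻¹) ^ n) * F ((normSqV v)⁻¹ • v) := by
  have : Nonempty (Fin n) := ⟨⟨0, hn⟩⟩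
  have hinv : ∀ v : V, v ≠ 0 → (normSqV ((normSqV v)⁻¹ • v))⁻¹ • ((normSqV v)⁻¹ • v) = v := by
    intro v hv
    have := normSqV_pos hv
    rw [normSqV_smul, smul_smul]
    have h : (((normSqV v)⁻¹ ^ 2 * normSqV v)⁻¹ * (normSqV v)⁻¹) = 1 := by field_simp
    rw [h, one_smul]
  have hne : ∀ v : V, v ≠ 0 → (normSqV v)⁻¹ • v ≠ 0 := fun v hv =>
    smul_ne_zero (inv_ne_zero (normSqV_pos hv).ne') hv
  have key := lintegral_image_eq_lintegral_abs_det_fderiv_mul (volume : Measure V)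
    (MeasurableSet.singleton (0 : V)).compl (f := fun v => (normSqV v)⁻¹ • v)
    (f' := inversionDeriv)
    (fun x hx => (hasFDerivAt_inversion hx).hasFDerivWithinAt)
    (fun x hx y hy hxy => by
      rw [← hinv x hx, ← hinv y hy]
      simp only at hxy
      rw [hxy]) F
  have himg : (fun v : V => (normSqV v)⁻¹ • v) '' {0}ᶜ = {0}ᶜ := by
    ext v
    constructor
    · rintro ⟨w, hw, rfl⟩
      exact hne w hw
    · intro hv
      exact ⟨_, hne v hv, hinv v hv⟩
  have : Nontrivial (EuclideanSpace ℝ (Fin n)) := inferInstance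
  have hz : (volume : Measure V) {0} = 0 :=
    (Measure.IsAddHaarMeasure.nullSingletonClass (volume : Measure V)).measure_singleton 0
  have hne0 : ∀ᵐ v : V, v ≠ 0 := by rw [ae_iff]; simpa using hz
  have hr : (volume : Measure V).restrict {0}ᶜ = volume :=
    Measure.restrict_eq_self_of_ae_mem hne0
  rw [himg, hr] at key
  rw [key]
  refine lintegral_congr_ae ?_
  filter_upwards [hne0] with v hv
  rw [abs_det_inversionDeriv hv]

end Plane


section Inversion

variable {n : ℕ}

local notation "V" => EuclideanSpace ℝ (Fin n) × EuclideanSpace ℝ (Fin n)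

/-- The function `(c + |v|²)² + 16 t²`. -/
def gauge (c : ℝ) (p : Heis n) : ℝ :=
  (c + (‖p.1‖ ^ 2 + ‖p.2.1‖ ^ 2)) ^ 2 + 16 * p.2.2 ^ 2

@[fun_prop]
lemma continuous_gauge (c : ℝ) : Continuous (gauge (n := n) c) := by unfold gauge; fun_prop

@[fun_prop]
lemma measurable_gauge (c : ℝ) : Measurable (gauge (n := n) c) := (continuous_gauge c).measurable

lemma gauge_nonneg (c : ℝ) (p : Heis n) : 0 ≤ gauge c p := by unfold gauge; positivity

lemma gauge_pos {c : ℝ} (hc : 0 < c) (p : Heis n) : 0 < gauge c p := by unfold gauge; positivity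

/-- The Korányi inversion on the Heisenberg group. -/
def kinv (p : Heis n) : Heis n :=
  ((gauge 0 p)⁻¹ • ((‖p.1‖ ^ 2 + ‖p.2.1‖ ^ 2) • p.1 - (4 * p.2.2) • p.2.1),
    (gauge 0 p)⁻¹ • ((‖p.1‖ ^ 2 + ‖p.2.1‖ ^ 2) • p.2.1 + (4 * p.2.2) • p.1),
    -((gauge 0 p)⁻¹ * p.2.2))

@[fun_prop]
lemma measurable_kinv : Measurable (kinv (n := n)) := by
  unfold kinv
  fun_prop

lemma lintegral_heis {F : Heis n → ℝ≥0∞} (hF : Measurable F) :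
    ∫⁻ p, F p = ∫⁻ v : V, ∫⁻ t : ℝ, F (v.1, v.2, t) := by
  have h := measurePreserving_prodAssoc (volume : Measure (EuclideanSpace ℝ (Fin n)))
    (volume : Measure (EuclideanSpace ℝ (Fin n))) (volume : Measure ℝ)
  have h1 := h.lintegral_comp hF
  exact h1.symm.trans (lintegral_prod _ (hF.comp h.measurable).aemeasurable)

lemma ae_ne_zero_plane (hn : 1 ≤ n) : ∀ᵐ v : V, v ≠ 0 := by
  have : Nonempty (Fin n) := ⟨⟨0, hn⟩⟩
  have : Nontrivial (EuclideanSpace ℝ (Fin n)) := inferInstance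
  rw [ae_iff]
  simpa using (Measure.IsAddHaarMeasure.nullSingletonClass (volume : Measure V)).measure_singleton 0

lemma lintegral_real_scale {c : ℝ} (hc : 0 < c) {g : ℝ → ℝ≥0∞} (hg : Measurable g) :
    ∫⁻ t, g t = ENNReal.ofReal c * ∫⁻ t, g (c * t) := by
  conv_lhs => rw [← Real.smul_map_volume_mul_left hc.ne']
  rw [lintegral_smul_measure, lintegral_map hg (by fun_prop), abs_of_pos hc, smul_eq_mul]

lemma lintegral_heis_scaled (hn : 1 ≤ n) {F : Heis n → ℝ≥0∞} (hF : Measurable F) :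
    ∫⁻ p, F p = ∫⁻ θ : ℝ, ∫⁻ v : V,
      ENNReal.ofReal (normSqV v) * F (v.1, v.2, normSqV v * θ) := by
  have hm := (continuous_normSqV (n := n)).measurable
  rw [lintegral_heis hF]
  symm
  rw [lintegral_lintegral_swap (by fun_prop)]
  refine lintegral_congr_ae ?_
  filter_upwards [ae_ne_zero_plane hn] with v hv
  have := lintegral_real_scale (normSqV_pos hv) (g := fun t => F (v.1, v.2, t)) (by fun_prop)
  rw [this, lintegral_const_mul _ (by fun_prop)]

lemma lintegral_kinv (hn : 1 ≤ n) {F : Heis n → ℝ≥0∞} (hF : Measurable F) :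
    ∫⁻ p, ENNReal.ofReal (((gauge 0 p) ^ (n + 1))⁻¹) * F (kinv p) = ∫⁻ p, F p := by
  rw [lintegral_heis_scaled hn hF, lintegral_heis_scaled hn (by fun_prop)]
  rw [← (Measure.measurePreserving_neg (volume : Measure ℝ)).lintegral_comp
    (f := fun θ => ∫⁻ v : V, ENNReal.ofReal (normSqV v) * F (v.1, v.2, normSqV v * θ)) (by
      have := (continuous_normSqV (n := n)).measurable
      fun_prop)]
  refine lintegral_congr fun θ => Eq.symm ?_
  set k : ℝ := (1 + 16 * θ ^ 2)⁻¹ with hk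
  have hk0 : 0 < k := by positivity
  have hk1 : (1 + 16 * θ ^ 2) = k⁻¹ := by rw [hk, inv_inv]
  have hkk : k ^ 2 + (4 * θ * k) ^ 2 = k := by
    have : k ^ 2 + (4 * θ * k) ^ 2 = k ^ 2 * (1 + 16 * θ ^ 2) := by ring
    rw [this, hk1]
    field_simp
  rw [lintegral_comp_cmul (α := k) (β := 4 * θ * k) (by rw [hkk]; exact hk0), hkk,
    lintegral_comp_inversion hn]
  refine lintegral_congr_ae ?_
  filter_upwards [ae_ne_zero_plane hn] with v hv
  have hp := normSqV_pos hv
  have hr : ‖v.1‖ ^ 2 + ‖v.2‖ ^ 2 = normSqV v := rfl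
  have hg : gauge 0 ((v.1, v.2, normSqV v * θ) : Heis n) = normSqV v ^ 2 * k⁻¹ := by
    simp only [gauge, hr, ← hk1]
    ring
  have hw : normSqV (cmul k (4 * θ * k) ((normSqV v)⁻¹ • v)) = k * (normSqV v)⁻¹ := by
    rw [normSqV_cmul, normSqV_smul, hkk]
    field_simp
  have hkinv : kinv ((v.1, v.2, normSqV v * θ) : Heis n)
      = ((cmul k (4 * θ * k) ((normSqV v)⁻¹ • v)).1, (cmul k (4 * θ * k) ((normSqV v)⁻¹ • v)).2,
        normSqV (cmul k (4 * θ * k) ((normSqV v)⁻¹ • v)) * -θ) := by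
    rw [hw]
    simp only [kinv, hg, hr, cmul_apply, Prod.smul_fst, Prod.smul_snd, smul_sub, smul_add,
      smul_smul]
    refine Prod.ext ?_ (Prod.ext ?_ ?_)
    · simp only
      congr 2 <;> field_simp
    · simp only
      congr 2 <;> field_simp
    · simp only
      field_simp
  rw [hkinv, hw, hg, eq_comm]
  rw [← mul_assoc, ← mul_assoc, ← mul_assoc, ← ENNReal.ofReal_mul hp.le,
    ← ENNReal.ofReal_mul (by positivity), ← ENNReal.ofReal_mul (by positivity)]
  congr 2
  have h : ((normSqV v ^ 2 * k⁻¹) ^ (n + 1))⁻¹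
      = ((normSqV v ^ 2)⁻¹) ^ n * k ^ n * ((normSqV v ^ 2)⁻¹ * k) := by
    rw [← mul_pow, ← pow_succ, ← inv_pow, mul_inv, inv_inv]
  rw [h]
  field_simp

lemma gauge_zero_ne_zero (hn : 1 ≤ n) : ∀ᵐ p : Heis n, 0 < gauge 0 p := by
  have : Nonempty (Fin n) := ⟨⟨0, hn⟩⟩
  have h0 : (volume : Measure (Heis n)) {0} = 0 := by
    change ((volume : Measure (EuclideanSpace ℝ (Fin n))).prod volume) {0} = 0
    exact measure_singleton _
  have : ∀ᵐ p : Heis n, p ≠ 0 := by rw [ae_iff]; simpa using h0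
  filter_upwards [this] with p hp
  refine (gauge_nonneg 0 p).lt_of_ne' fun h => hp ?_
  have h' : (0 + (‖p.1‖ ^ 2 + ‖p.2.1‖ ^ 2)) ^ 2 + 16 * p.2.2 ^ 2 = 0 := h
  have h3 : p.2.2 = 0 := by nlinarith [sq_nonneg (0 + (‖p.1‖ ^ 2 + ‖p.2.1‖ ^ 2)), sq_nonneg p.2.2]
  have h12 : ‖p.1‖ ^ 2 + ‖p.2.1‖ ^ 2 = 0 := by
    nlinarith [sq_nonneg (0 + (‖p.1‖ ^ 2 + ‖p.2.1‖ ^ 2)), sq_nonneg p.2.2]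
  have h1 : ‖p.1‖ ^ 2 = 0 := by nlinarith [sq_nonneg ‖p.1‖, sq_nonneg ‖p.2.1‖]
  have h2 : ‖p.2.1‖ ^ 2 = 0 := by nlinarith [sq_nonneg ‖p.1‖, sq_nonneg ‖p.2.1‖]
  refine Prod.ext (by simpa using h1) (Prod.ext (by simpa using h2) h3)

lemma map_kinv (hn : 1 ≤ n) :
    Measure.map kinv ((volume : Measure (Heis n)).withDensity
      fun p => ENNReal.ofReal (((gauge 0 p) ^ (n + 1))⁻¹)) = volume := by
  refine Measure.ext_of_lintegral _ fun F hF => ?_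
  rw [lintegral_map hF (by fun_prop), lintegral_withDensity_eq_lintegral_mul _ (by fun_prop)
    (by fun_prop), ← lintegral_kinv hn hF]
  rfl

lemma integrable_comp_kinv_iff (hn : 1 ≤ n) {F : Heis n → ℝ} (hF : Measurable F) :
    Integrable (fun p => ((gauge 0 p) ^ (n + 1))⁻¹ * F (kinv p)) ↔ Integrable F := by
  have h := (integrable_map_measure (μ := (volume : Measure (Heis n)).withDensity
      fun p => ENNReal.ofReal (((gauge 0 p) ^ (n + 1))⁻¹)) (f := kinv) (g := F)
      hF.aestronglyMeasurable (by fun_prop))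
  rw [map_kinv hn, integrable_withDensity_iff_integrable_smul' (by fun_prop) (by simp)] at h
  rw [h]
  refine integrable_congr (Eventually.of_forall fun p => ?_)
  have := gauge_nonneg 0 p
  simp only [smul_eq_mul, Function.comp]
  rw [ENNReal.toReal_ofReal (by positivity)]

lemma integral_comp_kinv (hn : 1 ≤ n) {F : Heis n → ℝ} (hF : Measurable F) :
    ∫ p, ((gauge 0 p) ^ (n + 1))⁻¹ * F (kinv p) = ∫ p, F p := by
  have h := integral_map (μ := (volume : Measure (Heis n)).withDensity
      fun p => ENNReal.ofReal (((gauge 0 p) ^ (n + 1))⁻¹)) (φ := kinv) (f := F)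
      (by fun_prop) hF.aestronglyMeasurable
  rw [map_kinv hn, integral_withDensity_eq_integral_toReal_smul (by fun_prop) (by simp)] at h
  rw [h]
  refine integral_congr_ae (Eventually.of_forall fun p => ?_)
  have := gauge_nonneg 0 p
  simp only [smul_eq_mul]
  rw [ENNReal.toReal_ofReal (by positivity)]

end Inversion


section Group

variable {n : ℕ}

lemma hmul_eq (p q : Heis n) : hmul p q = (p.1 + q.1, p.2.1 + q.2.1,
    p.2.2 + q.2.2 + 1 / 2 * (⟪p.2.1, q.1⟫ - ⟪p.1, q.2.1⟫)) := by
  simp only [hmul, PiLp.inner_apply, Finset.sum_sub_distrib]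
  simp [mul_comm]

lemma hmul_assoc (p q r : Heis n) : hmul (hmul p q) r = hmul p (hmul q r) := by
  simp only [hmul_eq, inner_add_left, inner_add_right]
  refine Prod.ext (add_assoc _ _ _) (Prod.ext (add_assoc _ _ _) ?_)
  simp only
  ring

lemma hinv_hmul_cancel (p q : Heis n) : hmul (hinv p) (hmul p q) = q := by
  simp only [hmul_eq, hinv, inner_add_right, inner_neg_left, real_inner_comm p.1 p.2.1]
  refine Prod.ext (by simp) (Prod.ext (by simp) ?_)
  simp only
  ring

lemma hinv_hinv (p : Heis n) : hinv (hinv p) = p := by simp [hinv]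

lemma hmul_hinv_cancel (p q : Heis n) : hmul p (hmul (hinv p) q) = q := by
  simpa [hinv_hinv] using hinv_hmul_cancel (hinv p) q

lemma hinv_hmul (p q : Heis n) : hinv (hmul (hinv q) p) = hmul (hinv p) q := by
  simp only [hmul_eq, hinv, inner_neg_left]
  refine Prod.ext (by simp [add_comm]) (Prod.ext (by simp [add_comm]) ?_)
  simp only [real_inner_comm p.1 q.2.1, real_inner_comm q.1 p.2.1]
  ring

lemma gauge_hinv (c : ℝ) (p : Heis n) : gauge c (hinv p) = gauge c p := by
  simp [gauge, hinv]

lemma gauge_hinv_hmul_comm (c : ℝ) (p q : Heis n) :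
    gauge c (hmul (hinv q) p) = gauge c (hmul (hinv p) q) := by
  rw [← hinv_hmul, gauge_hinv]

@[fun_prop]
lemma continuous_hinv : Continuous (hinv (n := n)) := by unfold hinv; fun_prop

lemma continuous_hmul : Continuous (fun z : Heis n × Heis n => hmul z.1 z.2) := by
  simp only [hmul_eq]
  fun_prop

lemma continuous_hmul_left (p : Heis n) : Continuous (hmul p) :=
  continuous_hmul.comp (Continuous.prodMk_right p)

lemma measurePreserving_hmul_left (p : Heis n) : MeasurePreserving (hmul p) := by
  have h : ∀ x : EuclideanSpace ℝ (Fin n), MeasurePreserving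
      (fun z : EuclideanSpace ℝ (Fin n) × ℝ => (p.2.1 + z.1,
        p.2.2 + z.2 + 1 / 2 * (⟪p.2.1, x⟫ - ⟪p.1, z.1⟫))) := by
    intro x
    refine (measurePreserving_add_left volume p.2.1).skew_product
      (g := fun y t => p.2.2 + t + 1 / 2 * (⟪p.2.1, x⟫ - ⟪p.1, y⟫)) (by fun_prop)
      (Eventually.of_forall fun y => ?_)
    have := (measurePreserving_add_right (volume : Measure ℝ)
      (p.2.2 + 1 / 2 * (⟪p.2.1, x⟫ - ⟪p.1, y⟫))).map_eq
    have he : (fun t => p.2.2 + t + 1 / 2 * (⟪p.2.1, x⟫ - ⟪p.1, y⟫))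
        = fun t => t + (p.2.2 + 1 / 2 * (⟪p.2.1, x⟫ - ⟪p.1, y⟫)) := by
      ext t
      ring
    rw [he]
    exact this
  have h2 := (measurePreserving_add_left (volume : Measure (EuclideanSpace ℝ (Fin n))) p.1).skew_product
    (g := fun x (z : EuclideanSpace ℝ (Fin n) × ℝ) => (p.2.1 + z.1,
        p.2.2 + z.2 + 1 / 2 * (⟪p.2.1, x⟫ - ⟪p.1, z.1⟫))) (by fun_prop)
      (Eventually.of_forall fun x => (h x).map_eq)
  rw [funext (hmul_eq p)]
  exact h2

lemma measurableEmbedding_hmul_left (p : Heis n) : MeasurableEmbedding (hmul p) :=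
  (MeasurableEquiv.mk ⟨hmul p, hmul (hinv p), hinv_hmul_cancel p, hmul_hinv_cancel p⟩
    (continuous_hmul_left p).measurable (continuous_hmul_left _).measurable).measurableEmbedding

lemma measurePreserving_prod_hmul :
    MeasurePreserving (fun z : Heis n × Heis n => (z.1, hmul (hinv z.1) z.2))
      (volume.prod volume) (volume.prod volume) :=
  (MeasurePreserving.id volume).skew_product
    (g := fun p q => hmul (hinv p) q)
    (continuous_hmul.comp (by fun_prop : Continuous fun z : Heis n × Heis n =>
      (hinv z.1, z.2))).measurable
    (Eventually.of_forall fun p => (measurePreserving_hmul_left _).map_eq)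

/-- The automorphism `(x, y, t) ↦ (ε x, η y, ε η t)` for signs `ε, η`. -/
def signAut (ε η : ℝ) (p : Heis n) : Heis n := (ε • p.1, η • p.2.1, ε * η * p.2.2)

lemma signAut_hmul (ε η : ℝ) (p q : Heis n) :
    signAut ε η (hmul p q) = hmul (signAut ε η p) (signAut ε η q) := by
  simp only [signAut, hmul_eq, inner_smul_left, inner_smul_right, smul_add]
  refine Prod.ext rfl (Prod.ext rfl ?_)
  simp
  ring

lemma gauge_signAut {ε η : ℝ} (hε : ε ^ 2 = 1) (hη : η ^ 2 = 1) (c : ℝ) (p : Heis n) :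
    gauge c (signAut ε η p) = gauge c p := by
  simp only [gauge, signAut, norm_smul, mul_pow, Real.norm_eq_abs, sq_abs, hε, hη]
  ring

lemma signAut_signAut {ε η : ℝ} (hε : ε ^ 2 = 1) (hη : η ^ 2 = 1) (p : Heis n) :
    signAut ε η (signAut ε η p) = p := by
  simp only [signAut, smul_smul, ← sq, hε, hη, one_smul]
  refine Prod.ext rfl (Prod.ext rfl ?_)
  simp only
  linear_combination (η ^ 2 * p.2.2) * hε + p.2.2 * hη

lemma continuous_signAut (ε η : ℝ) : Continuous (signAut (n := n) ε η) := by
  unfold signAut; fun_prop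

lemma measurePreserving_smul_of_sq_eq_one {E : Type*} [NormedAddCommGroup E] [NormedSpace ℝ E]
    [MeasurableSpace E] [BorelSpace E] [FiniteDimensional ℝ E] (μ : Measure E)
    [μ.IsAddHaarMeasure] {ε : ℝ} (hε : ε ^ 2 = 1) : MeasurePreserving (fun x : E => ε • x) μ μ := by
  refine ⟨by fun_prop, ?_⟩
  have h : ε * ε = 1 := by rw [← sq, hε]
  rcases mul_self_eq_one_iff.mp h with rfl | rfl
  · simp
  · simp

lemma measurePreserving_signAut {ε η : ℝ} (hε : ε ^ 2 = 1) (hη : η ^ 2 = 1) :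
    MeasurePreserving (signAut (n := n) ε η) :=
  (measurePreserving_smul_of_sq_eq_one volume hε).prod
    ((measurePreserving_smul_of_sq_eq_one volume hη).prod
      (measurePreserving_smul_of_sq_eq_one volume (ε := ε * η) (by rw [mul_pow, hε, hη, one_mul])))

lemma measurableEmbedding_signAut {ε η : ℝ} (hε : ε ^ 2 = 1) (hη : η ^ 2 = 1) :
    MeasurableEmbedding (signAut (n := n) ε η) :=
  (MeasurableEquiv.mk ⟨signAut ε η, signAut ε η, signAut_signAut hε hη, signAut_signAut hε hη⟩
    (continuous_signAut ε η).measurable (continuous_signAut ε η).measurable).measurableEmbedding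

/-- The conformal involution of the Siegel domain acting on points at height `c` over `p`. -/
def siegelInv (c : ℝ) (p : Heis n) : Heis n :=
  ((gauge c p)⁻¹ • ((c + (‖p.1‖ ^ 2 + ‖p.2.1‖ ^ 2)) • p.1 + (4 * p.2.2) • p.2.1),
    (gauge c p)⁻¹ • ((c + (‖p.1‖ ^ 2 + ‖p.2.1‖ ^ 2)) • p.2.1 - (4 * p.2.2) • p.1),
    -((gauge c p)⁻¹ * p.2.2))

lemma norm_sq_rotation {E : Type*} [NormedAddCommGroup E] [InnerProductSpace ℝ E]
    (k α β : ℝ) (x y : E) :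
    ‖k • (α • x - β • y)‖ ^ 2 + ‖k • (α • y + β • x)‖ ^ 2
      = k ^ 2 * (α ^ 2 + β ^ 2) * (‖x‖ ^ 2 + ‖y‖ ^ 2) := by
  simp only [norm_smul, mul_pow, norm_sub_sq_real, norm_add_sq_real, inner_smul_left,
    inner_smul_right, Real.norm_eq_abs, sq_abs, real_inner_comm x y]
  simp
  ring

lemma norm_sq_kinv {p : Heis n} (hp : 0 < gauge 0 p) :
    ‖(kinv p).1‖ ^ 2 + ‖(kinv p).2.1‖ ^ 2 = (gauge 0 p)⁻¹ * (‖p.1‖ ^ 2 + ‖p.2.1‖ ^ 2) := by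
  rw [kinv, norm_sq_rotation]
  have h : (‖p.1‖ ^ 2 + ‖p.2.1‖ ^ 2) ^ 2 + (4 * p.2.2) ^ 2 = gauge 0 p := by
    unfold gauge; ring
  rw [h]
  field_simp

lemma gauge_zero_kinv {p : Heis n} (hp : 0 < gauge 0 p) :
    gauge 0 (kinv p) = (gauge 0 p)⁻¹ := by
  have h1 := norm_sq_kinv hp
  rw [gauge, h1]
  simp only [kinv]
  have h : (‖p.1‖ ^ 2 + ‖p.2.1‖ ^ 2) ^ 2 + 16 * p.2.2 ^ 2 = gauge 0 p := by
    unfold gauge; ring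
  have : (0 + (gauge 0 p)⁻¹ * (‖p.1‖ ^ 2 + ‖p.2.1‖ ^ 2)) ^ 2 + 16 * (-((gauge 0 p)⁻¹ * p.2.2)) ^ 2
    = (gauge 0 p)⁻¹ ^ 2 * ((‖p.1‖ ^ 2 + ‖p.2.1‖ ^ 2) ^ 2 + 16 * p.2.2 ^ 2) := by ring
  rw [this, h]
  field_simp

lemma norm_sq_siegelInv {c : ℝ} (hc : 0 < c) (p : Heis n) :
    ‖(siegelInv c p).1‖ ^ 2 + ‖(siegelInv c p).2.1‖ ^ 2
      = (gauge c p)⁻¹ * (‖p.1‖ ^ 2 + ‖p.2.1‖ ^ 2) := by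
  have hp := gauge_pos hc p
  have := norm_sq_rotation (gauge c p)⁻¹ (c + (‖p.1‖ ^ 2 + ‖p.2.1‖ ^ 2)) (-(4 * p.2.2)) p.1 p.2.1
  rw [neg_smul, neg_smul, sub_neg_eq_add, ← sub_eq_add_neg] at this
  rw [siegelInv, this]
  have h : (c + (‖p.1‖ ^ 2 + ‖p.2.1‖ ^ 2)) ^ 2 + (-(4 * p.2.2)) ^ 2 = gauge c p := by
    unfold gauge; ring
  rw [h]
  field_simp

lemma gauge_siegelInv {c : ℝ} (hc : 0 < c) (p : Heis n) :
    gauge (c / gauge c p) (siegelInv c p) = (gauge c p)⁻¹ := by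
  have hp := gauge_pos hc p
  rw [gauge, norm_sq_siegelInv hc]
  simp only [siegelInv]
  have : (c / gauge c p + (gauge c p)⁻¹ * (‖p.1‖ ^ 2 + ‖p.2.1‖ ^ 2)) ^ 2
      + 16 * (-((gauge c p)⁻¹ * p.2.2)) ^ 2
    = (gauge c p)⁻¹ ^ 2 * ((c + (‖p.1‖ ^ 2 + ‖p.2.1‖ ^ 2)) ^ 2 + 16 * p.2.2 ^ 2) := by ring
  rw [this, ← gauge]
  field_simp

lemma siegelInv_siegelInv {c : ℝ} (hc : 0 < c) (p : Heis n) :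
    siegelInv (c / gauge c p) (siegelInv c p) = p := by
  have hp := gauge_pos hc p
  rw [siegelInv, gauge_siegelInv hc, norm_sq_siegelInv hc]
  have h0 : (c + (‖p.1‖ ^ 2 + ‖p.2.1‖ ^ 2)) ^ 2 + 16 * p.2.2 ^ 2 = gauge c p := rfl
  simp only [siegelInv]
  set M := gauge c p with hM
  set r := ‖p.1‖ ^ 2 + ‖p.2.1‖ ^ 2
  refine Prod.ext ?_ (Prod.ext ?_ ?_)
  · simp only [smul_add, smul_sub, smul_smul]
    have h1 : M⁻¹⁻¹ * ((c / M + M⁻¹ * r) * (M⁻¹ * (c + r)))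
        - M⁻¹⁻¹ * (4 * -(M⁻¹ * p.2.2) * (M⁻¹ * (4 * p.2.2))) = 1 := by
      field_simp
      rw [← h0]; ring
    have h2 : M⁻¹⁻¹ * ((c / M + M⁻¹ * r) * (M⁻¹ * (4 * p.2.2)))
        + M⁻¹⁻¹ * (4 * -(M⁻¹ * p.2.2) * (M⁻¹ * (c + r))) = 0 := by
      field_simp
      ring
    calc _ = (M⁻¹⁻¹ * ((c / M + M⁻¹ * r) * (M⁻¹ * (c + r)))
        - M⁻¹⁻¹ * (4 * -(M⁻¹ * p.2.2) * (M⁻¹ * (4 * p.2.2)))) • p.1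
        + (M⁻¹⁻¹ * ((c / M + M⁻¹ * r) * (M⁻¹ * (4 * p.2.2)))
        + M⁻¹⁻¹ * (4 * -(M⁻¹ * p.2.2) * (M⁻¹ * (c + r)))) • p.2.1 := by module
      _ = p.1 := by rw [h1, h2]; simp
  · simp only [smul_add, smul_sub, smul_smul]
    have h1 : M⁻¹⁻¹ * ((c / M + M⁻¹ * r) * (M⁻¹ * (c + r)))
        - M⁻¹⁻¹ * (4 * -(M⁻¹ * p.2.2) * (M⁻¹ * (4 * p.2.2))) = 1 := by
      field_simp
      rw [← h0]; ring
    have h2 : M⁻¹⁻¹ * ((c / M + M⁻¹ * r) * (M⁻¹ * (4 * p.2.2)))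
        + M⁻¹⁻¹ * (4 * -(M⁻¹ * p.2.2) * (M⁻¹ * (c + r))) = 0 := by
      field_simp
      ring
    calc _ = (M⁻¹⁻¹ * ((c / M + M⁻¹ * r) * (M⁻¹ * (c + r)))
        - M⁻¹⁻¹ * (4 * -(M⁻¹ * p.2.2) * (M⁻¹ * (4 * p.2.2)))) • p.2.1
        - (M⁻¹⁻¹ * ((c / M + M⁻¹ * r) * (M⁻¹ * (4 * p.2.2)))
        + M⁻¹⁻¹ * (4 * -(M⁻¹ * p.2.2) * (M⁻¹ * (c + r)))) • p.1 := by module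
      _ = p.2.1 := by rw [h1, h2]; simp
  · simp only
    field_simp

lemma siegel_identity_aux {c P U A B t τ M N : ℝ} (hM : M = (c + P) ^ 2 + 16 * t ^ 2)
    (hN : N = U ^ 2 + 16 * τ ^ 2) (hM0 : 0 < M) (hN0 : 0 < N) :
    (c + (P + 2 * (N⁻¹ * (U * A + 4 * τ * B)) + N⁻¹ * U)) ^ 2
        + 16 * (t + -(N⁻¹ * τ) + 1 / 2 * (N⁻¹ * (U * B - 4 * τ * A))) ^ 2
      = M / N * ((c / M + (M⁻¹ * P + 2 * (M⁻¹ * ((c + P) * A + 4 * t * B)) + U)) ^ 2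
        + 16 * (-(M⁻¹ * t) + τ + 1 / 2 * (M⁻¹ * ((c + P) * B - 4 * t * A))) ^ 2) := by
  have h1 : ∀ X Y : ℝ, X ^ 2 + 16 * Y ^ 2 = N⁻¹ ^ 2 * ((N * X) ^ 2 + 16 * (N * Y) ^ 2) := by
    intro X Y; field_simp
  have h2 : ∀ X Y : ℝ, X ^ 2 + 16 * Y ^ 2 = M⁻¹ ^ 2 * ((M * X) ^ 2 + 16 * (M * Y) ^ 2) := by
    intro X Y; field_simp
  rw [h1, h2 (c / M + _)]
  have e1 : N * (c + (P + 2 * (N⁻¹ * (U * A + 4 * τ * B)) + N⁻¹ * U))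
    = N * (c + P) + 2 * (U * A + 4 * τ * B) + U := by field_simp; ring
  have e2 : N * (t + -(N⁻¹ * τ) + 1 / 2 * (N⁻¹ * (U * B - 4 * τ * A)))
    = N * t - τ + (U * B - 4 * τ * A) / 2 := by field_simp; ring
  have e3 : M * (c / M + (M⁻¹ * P + 2 * (M⁻¹ * ((c + P) * A + 4 * t * B)) + U))
    = c + P + 2 * ((c + P) * A + 4 * t * B) + M * U := by field_simp; ring
  have e4 : M * (-(M⁻¹ * t) + τ + 1 / 2 * (M⁻¹ * ((c + P) * B - 4 * t * A)))
    = -t + M * τ + ((c + P) * B - 4 * t * A) / 2 := by field_simp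
  rw [e1, e2, e3, e4]
  field_simp
  rw [hM, hN]
  ring

lemma norm_sq_hmul (p q : Heis n) :
    ‖(hmul p q).1‖ ^ 2 + ‖(hmul p q).2.1‖ ^ 2 = (‖p.1‖ ^ 2 + ‖p.2.1‖ ^ 2)
      + 2 * (⟪p.1, q.1⟫ + ⟪p.2.1, q.2.1⟫) + (‖q.1‖ ^ 2 + ‖q.2.1‖ ^ 2) := by
  simp only [hmul_eq, norm_add_sq_real]
  ring

lemma gauge_hmul (c : ℝ) (p q : Heis n) :
    gauge c (hmul p q) = (c + ((‖p.1‖ ^ 2 + ‖p.2.1‖ ^ 2)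
      + 2 * (⟪p.1, q.1⟫ + ⟪p.2.1, q.2.1⟫) + (‖q.1‖ ^ 2 + ‖q.2.1‖ ^ 2))) ^ 2
      + 16 * (p.2.2 + q.2.2 + 1 / 2 * (⟪p.2.1, q.1⟫ - ⟪p.1, q.2.1⟫)) ^ 2 := by
  rw [gauge, norm_sq_hmul, hmul_eq]

lemma gauge_hmul_kinv {c : ℝ} (hc : 0 < c) (p : Heis n) {g : Heis n} (hg : 0 < gauge 0 g) :
    gauge c (hmul p (kinv g))
      = gauge c p / gauge 0 g * gauge (c / gauge c p) (hmul (siegelInv c p) g) := by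
  have key := siegel_identity_aux (c := c) (P := ‖p.1‖ ^ 2 + ‖p.2.1‖ ^ 2)
    (U := ‖g.1‖ ^ 2 + ‖g.2.1‖ ^ 2) (A := ⟪p.1, g.1⟫ + ⟪p.2.1, g.2.1⟫)
    (B := ⟪p.2.1, g.1⟫ - ⟪p.1, g.2.1⟫) (t := p.2.2) (τ := g.2.2) (M := gauge c p)
    (N := gauge 0 g) rfl (by unfold gauge; ring) (gauge_pos hc p) hg
  rw [gauge_hmul, gauge_hmul, norm_sq_kinv hg, norm_sq_siegelInv hc]
  simp only [kinv, siegelInv, inner_smul_left, inner_smul_right, inner_add_left, inner_add_right,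
    inner_sub_left, inner_sub_right, RCLike.conj_to_real]
  refine Eq.trans ?_ (key.trans ?_) <;> ring

end Group


section Constants

variable {n : ℕ}

local notation "Plane" => EuclideanSpace ℝ (Fin n) × EuclideanSpace ℝ (Fin n)

lemma lintegral_rpow_mul_exp {a r : ℝ} (ha : 0 < a) (hr : 0 < r) :
    ∫⁻ x in Ioi (0 : ℝ), ENNReal.ofReal (x ^ (a - 1) * exp (-(r * x)))
      = ENNReal.ofReal (Gamma a * r ^ (-a)) := by
  have h := Real.integral_rpow_mul_exp_neg_mul_Ioi ha hr
  have hG := Gamma_pos_of_pos ha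
  have hi : IntegrableOn (fun x : ℝ => x ^ (a - 1) * exp (-(r * x))) (Ioi 0) := by
    refine Integrable.of_integral_ne_zero ?_
    rw [h]
    positivity
  rw [← ofReal_integral_eq_lintegral_ofReal hi, h, rpow_neg hr.le, one_div, inv_rpow hr.le,
    mul_comm]
  filter_upwards [ae_restrict_mem measurableSet_Ioi] with x hx
  have : (0 : ℝ) < x := hx
  positivity

lemma lintegral_rpow_of_gaussian {α : Type*} [MeasurableSpace α] {μ : Measure α} [SFinite μ]
    {q : α → ℝ} (hq : Measurable q) (hq0 : ∀ a, 0 ≤ q a) {k d : ℝ} (hk : 0 ≤ k) (hd : 0 ≤ d)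
    (h : ∀ x : ℝ, 0 < x → ∫⁻ a, ENNReal.ofReal (exp (-(q a * x))) ∂μ
      = ENNReal.ofReal (k * x ^ (-d)))
    {b c : ℝ} (hb : d < b) (hc : 0 < c) :
    ∫⁻ a, ENNReal.ofReal ((c + q a) ^ (-b)) ∂μ
      = ENNReal.ofReal (k * (Gamma (b - d) / Gamma b) * c ^ (d - b)) := by
  have hb0 : 0 < b := hd.trans_lt hb
  have hG := Gamma_pos_of_pos hb0
  have h1 : ∀ a, ENNReal.ofReal ((c + q a) ^ (-b)) = ENNReal.ofReal (Gamma b)⁻¹ *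
      ∫⁻ x in Ioi (0 : ℝ), ENNReal.ofReal (x ^ (b - 1) * exp (-((c + q a) * x))) := by
    intro a
    have := hq0 a
    rw [lintegral_rpow_mul_exp hb0 (by positivity), ← ENNReal.ofReal_mul (by positivity)]
    congr 1
    field_simp
  simp_rw [h1]
  rw [lintegral_const_mul _ (by fun_prop), lintegral_lintegral_swap (by fun_prop)]
  have h2 : ∀ x ∈ Ioi (0 : ℝ),
      ∫⁻ a, ENNReal.ofReal (x ^ (b - 1) * exp (-((c + q a) * x))) ∂μ
        = ENNReal.ofReal k * ENNReal.ofReal (x ^ ((b - d) - 1) * exp (-(c * x))) := by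
    intro x hx
    have hx : 0 < x := hx
    have : ∀ a, ENNReal.ofReal (x ^ (b - 1) * exp (-((c + q a) * x)))
        = ENNReal.ofReal (x ^ (b - 1) * exp (-(c * x))) * ENNReal.ofReal (exp (-(q a * x))) := by
      intro a
      rw [← ENNReal.ofReal_mul (by positivity), mul_assoc, ← exp_add]
      congr 3
      ring
    simp_rw [this]
    rw [lintegral_const_mul _ (by fun_prop), h x hx, ← ENNReal.ofReal_mul (by positivity),
      ← ENNReal.ofReal_mul hk]
    congr 1
    have : x ^ ((b - d) - 1) = x ^ (b - 1) * x ^ (-d) := by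
      rw [← rpow_add hx]; congr 1; ring
    rw [this]
    ring
  rw [setLIntegral_congr_fun measurableSet_Ioi h2, lintegral_const_mul _ (by fun_prop),
    lintegral_rpow_mul_exp (sub_pos.mpr hb) hc, ← ENNReal.ofReal_mul hk,
    ← ENNReal.ofReal_mul (by positivity), neg_sub]
  congr 1
  field_simp

lemma lintegral_gaussian_real {x : ℝ} (hx : 0 < x) :
    ∫⁻ t : ℝ, ENNReal.ofReal (exp (-(16 * t ^ 2 * x)))
      = ENNReal.ofReal (√π / 4 * x ^ (-(1 / 2) : ℝ)) := by
  have h := integral_gaussian (16 * x)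
  have he : (fun t : ℝ => exp (-(16 * t ^ 2 * x))) = fun t => exp (-(16 * x) * t ^ 2) := by
    ext t; congr 1; ring
  rw [← ofReal_integral_eq_lintegral_ofReal (by
    rw [he]; exact integrable_exp_neg_mul_sq (by positivity))
    (Eventually.of_forall fun t => (exp_pos _).le), he, h]
  congr 1
  rw [sqrt_div pi_pos.le, sqrt_mul (by norm_num), rpow_neg hx.le, ← sqrt_eq_rpow]
  have : √(16 : ℝ) = 4 := by rw [show (16 : ℝ) = 4 ^ 2 by norm_num]; exact sqrt_sq (by norm_num)
  rw [this]
  field_simp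

lemma lintegral_gaussian_plane {x : ℝ} (hx : 0 < x) :
    ∫⁻ v : Plane, ENNReal.ofReal (exp (-((‖v.1‖ ^ 2 + ‖v.2‖ ^ 2) * x)))
      = ENNReal.ofReal (π ^ n * x ^ (-(n : ℝ))) := by
  have h1 : ∫⁻ y : EuclideanSpace ℝ (Fin n), ENNReal.ofReal (exp (-(x * ‖y‖ ^ 2)))
      = ENNReal.ofReal ((π / x) ^ ((n : ℝ) / 2)) := by
    have h := GaussianFourier.integral_rexp_neg_mul_sq_norm
      (V := EuclideanSpace ℝ (Fin n)) hx
    rw [finrank_euclideanSpace_fin] at h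
    simp_rw [neg_mul] at h
    rw [← h, ofReal_integral_eq_lintegral_ofReal]
    · refine Integrable.of_integral_ne_zero ?_
      rw [h]
      positivity
    · exact Eventually.of_forall fun t => (exp_pos _).le
  have h2 : ∀ v : Plane, ENNReal.ofReal (exp (-((‖v.1‖ ^ 2 + ‖v.2‖ ^ 2) * x)))
      = ENNReal.ofReal (exp (-(x * ‖v.1‖ ^ 2))) * ENNReal.ofReal (exp (-(x * ‖v.2‖ ^ 2))) := by
    intro v
    rw [← ENNReal.ofReal_mul (exp_pos _).le, ← exp_add]
    congr 2
    ring
  simp_rw [h2]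
  have h3 := lintegral_prod_mul (μ := (volume : Measure (EuclideanSpace ℝ (Fin n))))
    (ν := (volume : Measure (EuclideanSpace ℝ (Fin n))))
    (f := fun y => ENNReal.ofReal (exp (-(x * ‖y‖ ^ 2))))
    (g := fun y => ENNReal.ofReal (exp (-(x * ‖y‖ ^ 2)))) (by fun_prop) (by fun_prop)
  refine h3.trans ?_
  rw [h1, ← ENNReal.ofReal_mul (by positivity), ← rpow_add (by positivity), add_halves,
    rpow_natCast, div_pow, rpow_neg hx.le, rpow_natCast, div_eq_mul_inv]

lemma lintegral_sq_add_rpow {R b : ℝ} (hR : 0 < R) (hb : 1 / 2 < b) :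
    ∫⁻ t : ℝ, ENNReal.ofReal ((R ^ 2 + 16 * t ^ 2) ^ (-b))
      = ENNReal.ofReal (√π / 4 * (Gamma (b - 1 / 2) / Gamma b)) *
        ENNReal.ofReal (R ^ (-(2 * b - 1))) := by
  have h := lintegral_rpow_of_gaussian (μ := (volume : Measure ℝ)) (q := fun t : ℝ => 16 * t ^ 2)
    (by fun_prop) (fun t => by positivity) (k := √π / 4) (d := 1 / 2) (by positivity)
    (by norm_num) (fun x hx => lintegral_gaussian_real hx) hb (pow_pos hR 2)
  have h1 := Gamma_pos_of_pos (show 0 < b by linarith)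
  have h2 := Gamma_pos_of_pos (show 0 < b - 1 / 2 by linarith)
  rw [h, ← ENNReal.ofReal_mul (by positivity), ← rpow_natCast R 2, ← rpow_mul hR.le]
  congr 3
  push_cast
  ring

lemma lintegral_plane_rpow {b c : ℝ} (hb : (n : ℝ) < b) (hc : 0 < c) :
    ∫⁻ v : Plane, ENNReal.ofReal ((c + (‖v.1‖ ^ 2 + ‖v.2‖ ^ 2)) ^ (-b))
      = ENNReal.ofReal (π ^ n * (Gamma (b - n) / Gamma b) * c ^ ((n : ℝ) - b)) :=
  lintegral_rpow_of_gaussian (μ := (volume : Measure Plane)) (q := fun v => ‖v.1‖ ^ 2 + ‖v.2‖ ^ 2)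
    (by fun_prop) (fun t => by positivity) (by positivity)
    (by positivity) (fun x hx => lintegral_gaussian_plane hx) hb hc

lemma lintegral_gauge_rpow_lt_top {b c : ℝ} (hb : (n + 1 : ℝ) < 2 * b) (hc : 0 < c) :
    ∫⁻ p : Heis n, ENNReal.ofReal (gauge c p ^ (-b)) < ⊤ := by
  have hn0 : (0 : ℝ) ≤ n := by positivity
  rw [lintegral_heis (by fun_prop)]
  have h1 : ∀ v : Plane, ∫⁻ t : ℝ, ENNReal.ofReal (gauge c ((v.1, v.2, t) : Heis n) ^ (-b))
      = ENNReal.ofReal (√π / 4 * (Gamma (b - 1 / 2) / Gamma b)) *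
        ENNReal.ofReal ((c + (‖v.1‖ ^ 2 + ‖v.2‖ ^ 2)) ^ (-(2 * b - 1))) := by
    intro v
    have hv : 0 < c + (‖v.1‖ ^ 2 + ‖v.2‖ ^ 2) := by positivity
    simp only [gauge]
    exact lintegral_sq_add_rpow hv (by linarith)
  simp_rw [h1]
  rw [lintegral_const_mul _ (by fun_prop), lintegral_plane_rpow (by linarith) hc]
  exact ENNReal.mul_lt_top ENNReal.ofReal_lt_top ENNReal.ofReal_lt_top

lemma integrable_gauge_rpow {b c : ℝ} (hb : (n + 1 : ℝ) < 2 * b) (hc : 0 < c) :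
    Integrable (fun p : Heis n => gauge c p ^ (-b)) :=
  (lintegral_ofReal_ne_top_iff_integrable
    (by fun_prop : Measurable _).aestronglyMeasurable (Eventually.of_forall fun p =>
    rpow_nonneg (gauge_nonneg c p) _)).mp (lintegral_gauge_rpow_lt_top hb hc).ne

/-- The integral of `gauge 0 ^ (-(m / 2)) - gauge 1 ^ (-(m / 2))` for `m = n + 1 - s`. -/
def defectConst (n : ℕ) (s : ℝ) : ℝ :=
  ((n : ℝ) + 1 - s) * (√π / 4 * (Gamma (((n : ℝ) + 1 - s) / 2 + 1 - 1 / 2) /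
    Gamma (((n : ℝ) + 1 - s) / 2 + 1))) * (π ^ n * (Gamma (1 - s) / Gamma ((n : ℝ) + 1 - s))) / s

lemma gauge_mono {c d : ℝ} (hc : 0 ≤ c) (hcd : c ≤ d) (p : Heis n) : gauge c p ≤ gauge d p := by
  unfold gauge
  gcongr

lemma lintegral_deriv_gauge {m c : ℝ} (hc : 0 ≤ c) (hm : 0 < m) {p : Heis n}
    (hp : 0 < gauge 0 p) :
    ∫⁻ u in Ioc 0 c, ENNReal.ofReal (m * (u + (‖p.1‖ ^ 2 + ‖p.2.1‖ ^ 2)) *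
        gauge u p ^ (-(m / 2 + 1)))
      = ENNReal.ofReal (gauge 0 p ^ (-(m / 2)) - gauge c p ^ (-(m / 2))) := by
  have hpos : ∀ u, 0 ≤ u → 0 < gauge u p := fun u hu => hp.trans_le (gauge_mono le_rfl hu p)
  have hd : ∀ u ∈ uIcc 0 c, HasDerivAt (fun u => -(gauge u p ^ (-(m / 2))))
      (m * (u + (‖p.1‖ ^ 2 + ‖p.2.1‖ ^ 2)) * gauge u p ^ (-(m / 2 + 1))) u := by
    intro u hu
    rw [uIcc_of_le hc] at hu
    have h1 : HasDerivAt (fun u => gauge u p) (2 * (u + (‖p.1‖ ^ 2 + ‖p.2.1‖ ^ 2))) u := by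
      unfold gauge
      simpa using (((hasDerivAt_id u).add_const (‖p.1‖ ^ 2 + ‖p.2.1‖ ^ 2)).pow 2).add_const
        (16 * p.2.2 ^ 2)
    refine (h1.rpow_const (p := -(m / 2)) (Or.inl (hpos u hu.1).ne')).neg.congr_deriv ?_
    rw [show -(m / 2 + 1) = -(m / 2) - 1 by ring]
    ring
  have hcont : ContinuousOn (fun u => m * (u + (‖p.1‖ ^ 2 + ‖p.2.1‖ ^ 2)) *
      gauge u p ^ (-(m / 2 + 1))) (uIcc 0 c) := by
    rw [uIcc_of_le hc]
    refine ContinuousOn.mul (by fun_prop) (ContinuousOn.rpow_const ?_ fun u hu =>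
      Or.inl (hpos u hu.1).ne')
    unfold gauge
    fun_prop
  have h := intervalIntegral.integral_eq_sub_of_hasDerivAt hd hcont.intervalIntegrable
  rw [intervalIntegral.integral_of_le hc] at h
  rw [← ofReal_integral_eq_lintegral_ofReal
    ((intervalIntegrable_iff_integrableOn_Ioc_of_le hc).mp hcont.intervalIntegrable), h]
  · congr 1
    ring
  · filter_upwards [ae_restrict_mem measurableSet_Ioc] with u hu
    have := hpos u hu.1.le
    have := hu.1
    positivity

lemma lintegral_defect (hn : 1 ≤ n) {s c : ℝ} (hs : 0 < s) (hs1 : s < 1) (hc : 0 ≤ c) :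
    ∫⁻ p : Heis n, ENNReal.ofReal (gauge 0 p ^ (-(((n : ℝ) + 1 - s) / 2)) -
        gauge c p ^ (-(((n : ℝ) + 1 - s) / 2)))
      = ENNReal.ofReal (defectConst n s * c ^ s) := by
  set m : ℝ := (n : ℝ) + 1 - s with hm
  have hn0 : (0 : ℝ) ≤ n := by positivity
  have hm0 : 0 < m := by linarith
  have hG1 := Gamma_pos_of_pos (show 0 < m / 2 + 1 - 1 / 2 by linarith)
  have hG2 := Gamma_pos_of_pos (show 0 < m / 2 + 1 by linarith)
  have hG3 := Gamma_pos_of_pos hm0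
  have hG4 := Gamma_pos_of_pos (show 0 < 1 - s by linarith)
  have hgm : Measurable fun z : Heis n × ℝ => gauge z.2 z.1 := by unfold gauge; fun_prop
  have h1 : ∫⁻ p : Heis n, ENNReal.ofReal (gauge 0 p ^ (-(m / 2)) - gauge c p ^ (-(m / 2)))
      = ∫⁻ p : Heis n, ∫⁻ u in Ioc 0 c, ENNReal.ofReal (m * (u + (‖p.1‖ ^ 2 + ‖p.2.1‖ ^ 2)) *
        gauge u p ^ (-(m / 2 + 1))) := by
    refine lintegral_congr_ae ?_
    filter_upwards [gauge_zero_ne_zero hn] with p hp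
    exact (lintegral_deriv_gauge hc hm0 hp).symm
  rw [h1, lintegral_lintegral_swap (by fun_prop)]
  have h2 : ∀ u ∈ Ioc 0 c, ∫⁻ p : Heis n, ENNReal.ofReal (m * (u + (‖p.1‖ ^ 2 + ‖p.2.1‖ ^ 2)) *
        gauge u p ^ (-(m / 2 + 1)))
      = ENNReal.ofReal (m * (√π / 4 * (Gamma (m / 2 + 1 - 1 / 2) / Gamma (m / 2 + 1))) *
        (π ^ n * (Gamma (1 - s) / Gamma m))) * ENNReal.ofReal (u ^ (s - 1)) := by
    intro u hu
    have hu : 0 < u := hu.1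
    rw [lintegral_heis (by fun_prop)]
    have h3 : ∀ v : Plane, ∫⁻ t : ℝ, ENNReal.ofReal (m * (u + (‖v.1‖ ^ 2 + ‖v.2‖ ^ 2)) *
        gauge u ((v.1, v.2, t) : Heis n) ^ (-(m / 2 + 1)))
      = ENNReal.ofReal (m * (√π / 4 * (Gamma (m / 2 + 1 - 1 / 2) / Gamma (m / 2 + 1)))) *
        ENNReal.ofReal ((u + (‖v.1‖ ^ 2 + ‖v.2‖ ^ 2)) ^ (-m)) := by
      intro v
      have hv : 0 < u + (‖v.1‖ ^ 2 + ‖v.2‖ ^ 2) := by positivity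
      have := lintegral_sq_add_rpow hv (b := m / 2 + 1) (by linarith)
      simp_rw [ENNReal.ofReal_mul (show 0 ≤ m * (u + (‖v.1‖ ^ 2 + ‖v.2‖ ^ 2)) by positivity)]
      rw [lintegral_const_mul _ (by fun_prop)]
      change _ * ∫⁻ t : ℝ, ENNReal.ofReal (((u + (‖v.1‖ ^ 2 + ‖v.2‖ ^ 2)) ^ 2 + 16 * t ^ 2)
        ^ (-(m / 2 + 1))) = _
      rw [this, ← ENNReal.ofReal_mul (by positivity), ← ENNReal.ofReal_mul (by positivity),
        ← ENNReal.ofReal_mul (by positivity)]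
      congr 1
      rw [show -(2 * (m / 2 + 1) - 1) = -m - 1 by ring, rpow_sub_one hv.ne']
      field_simp
    simp_rw [h3]
    rw [lintegral_const_mul _ (by fun_prop), lintegral_plane_rpow (by linarith) hu,
      ← ENNReal.ofReal_mul (by positivity), ← ENNReal.ofReal_mul (by positivity),
      show m - (n : ℝ) = 1 - s by rw [hm]; ring, show (n : ℝ) - m = s - 1 by rw [hm]; ring]
    congr 1
    ring
  rw [setLIntegral_congr_fun measurableSet_Ioc h2, lintegral_const_mul _ (by fun_prop)]
  have h4 : ∫⁻ u in Ioc 0 c, ENNReal.ofReal (u ^ (s - 1)) = ENNReal.ofReal (c ^ s / s) := by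
    have hi := intervalIntegral.intervalIntegrable_rpow' (a := 0) (b := c)
      (show -1 < s - 1 by linarith)
    have h5 := integral_rpow (a := 0) (b := c) (r := s - 1) (Or.inl (by linarith))
    rw [intervalIntegral.integral_of_le hc, sub_add_cancel, zero_rpow hs.ne', sub_zero] at h5
    rw [← h5, ofReal_integral_eq_lintegral_ofReal
      ((intervalIntegrable_iff_integrableOn_Ioc_of_le hc).mp hi)]
    filter_upwards [ae_restrict_mem measurableSet_Ioc] with u hu
    have := hu.1
    positivity
  rw [h4, ← ENNReal.ofReal_mul (by positivity)]
  congr 1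
  simp only [defectConst, ← hm]
  ring

lemma defect_nonneg {m c : ℝ} (hc : 0 ≤ c) (hm : 0 ≤ m) {p : Heis n} (hp : 0 < gauge 0 p) :
    0 ≤ gauge 0 p ^ (-m) - gauge c p ^ (-m) :=
  sub_nonneg.mpr (rpow_le_rpow_of_nonpos hp (gauge_mono le_rfl hc p) (by linarith))

lemma integrable_defect (hn : 1 ≤ n) {s c : ℝ} (hs : 0 < s) (hs1 : s < 1) (hc : 0 ≤ c) :
    Integrable fun p : Heis n => gauge 0 p ^ (-(((n : ℝ) + 1 - s) / 2)) -
        gauge c p ^ (-(((n : ℝ) + 1 - s) / 2)) := by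
  have hn0 : (0 : ℝ) ≤ n := by positivity
  rw [← lintegral_ofReal_ne_top_iff_integrable (by fun_prop : Measurable _).aestronglyMeasurable,
    lintegral_defect hn hs hs1 hc]
  · exact ENNReal.ofReal_ne_top
  · filter_upwards [gauge_zero_ne_zero hn] with p hp
    exact defect_nonneg hc (by linarith) hp

lemma integral_defect (hn : 1 ≤ n) {s c : ℝ} (hs : 0 < s) (hs1 : s < 1) (hc : 0 ≤ c) :
    ∫ p : Heis n, (gauge 0 p ^ (-(((n : ℝ) + 1 - s) / 2)) -
        gauge c p ^ (-(((n : ℝ) + 1 - s) / 2))) = defectConst n s * c ^ s := by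
  have hn0 : (0 : ℝ) ≤ n := by positivity
  rw [integral_eq_lintegral_of_nonneg_ae, lintegral_defect hn hs hs1 hc, ENNReal.toReal_ofReal]
  · have hG1 := Gamma_pos_of_pos (show 0 < ((n : ℝ) + 1 - s) / 2 + 1 - 1 / 2 by linarith)
    have hG2 := Gamma_pos_of_pos (show 0 < ((n : ℝ) + 1 - s) / 2 + 1 by linarith)
    have hG3 := Gamma_pos_of_pos (show 0 < (n : ℝ) + 1 - s by linarith)
    have hG4 := Gamma_pos_of_pos (show 0 < 1 - s by linarith)
    have : 0 < (n : ℝ) + 1 - s := by linarith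
    unfold defectConst
    positivity
  · filter_upwards [gauge_zero_ne_zero hn] with p hp
    exact defect_nonneg hc (by linarith) hp
  · exact (by fun_prop : Measurable _).aestronglyMeasurable

lemma mul_defectConst {s : ℝ} (hs : 0 < s) (hs1 : s < 1) :
    (4 : ℝ) ^ (1 + s) * s / π ^ ((n : ℝ) + 1 / 2) *
        (Gamma ((n : ℝ) + s) * Gamma (((n : ℝ) + 1 + s) / 2)) /
        (Gamma (((n : ℝ) + s) / 2) * Gamma (1 - s)) * defectConst n s
      = (4 : ℝ) ^ (2 * s) *
        (Gamma (((n : ℝ) + 1 + s) / 2) / Gamma (((n : ℝ) + 1 - s) / 2)) ^ 2 := by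
  have hn0 : (0 : ℝ) ≤ n := by positivity
  set m : ℝ := (n : ℝ) + 1 - s with hm
  have hm0 : 0 < m := by linarith
  have hG1 := Gamma_pos_of_pos (show 0 < m / 2 + 1 / 2 by linarith)
  have hG2 := Gamma_pos_of_pos (show 0 < m / 2 by linarith)
  have hG3 := Gamma_pos_of_pos hm0
  have hG4 := Gamma_pos_of_pos (show 0 < 1 - s by linarith)
  have hG5 := Gamma_pos_of_pos (show 0 < ((n : ℝ) + s) / 2 by linarith)
  have hG6 := Gamma_pos_of_pos (show 0 < ((n : ℝ) + 1 + s) / 2 by linarith)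
  have d1 := Gamma_mul_Gamma_add_half (m / 2)
  have d2 := Gamma_mul_Gamma_add_half (((n : ℝ) + s) / 2)
  rw [show 2 * (m / 2) = m by ring] at d1
  rw [show 2 * (((n : ℝ) + s) / 2) = n + s by ring,
    show ((n : ℝ) + s) / 2 + 1 / 2 = ((n : ℝ) + 1 + s) / 2 by ring] at d2
  have e1 : Gamma (m / 2 + 1) = m / 2 * Gamma (m / 2) := Gamma_add_one (by positivity)
  have e2 : m / 2 + 1 - 1 / 2 = m / 2 + 1 / 2 := by ring
  have e3 : π ^ ((n : ℝ) + 1 / 2) = π ^ n * √π := by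
    rw [rpow_add pi_pos, rpow_natCast, ← sqrt_eq_rpow]
  have h2 : (0 : ℝ) < 2 := by norm_num
  have e4 : (4 : ℝ) ^ (1 + s) = 4 * 2 ^ (2 * s) := by
    rw [rpow_add (by norm_num), rpow_one, rpow_mul (by norm_num)]; norm_num
  have e5 : (4 : ℝ) ^ (2 * s) = 2 ^ (2 * s) * 2 ^ (2 * s) := by
    rw [← rpow_add h2, show 2 * s + 2 * s = 2 * (2 * s) by ring, rpow_mul h2.le 2 (2 * s)]
    norm_num
  have e6 : (2 : ℝ) ^ (1 - m) = 2 ^ (2 * s) * 2 ^ (1 - ((n : ℝ) + s)) / 2 := by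
    rw [← rpow_add h2, ← rpow_sub_one h2.ne']
    congr 1
    rw [hm]; ring
  have e7 : Gamma (m / 2 + 1 / 2)
      = Gamma m * (2 ^ (2 * s) * 2 ^ (1 - ((n : ℝ) + s)) / 2) * √π / Gamma (m / 2) := by
    rw [eq_div_iff hG2.ne', mul_comm, d1, e6]
  have hπ : 0 < √π := sqrt_pos.mpr pi_pos
  simp only [defectConst, ← hm]
  rw [e1, e2, e3, e4, e5, e7]
  field_simp
  linear_combination -d2

end Constants

section Domination

variable {n : ℕ}

lemma integrable_indicator_gauge (b : ℝ) (hb : (n + 1 : ℝ) < 2 * b) :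
    Integrable ({p : Heis n | 1 ≤ gauge 0 p}.indicator fun p => gauge 0 p ^ (-b)) := by
  have hn0 : (0 : ℝ) ≤ n := by positivity
  have hs : MeasurableSet {p : Heis n | 1 ≤ gauge 0 p} :=
    measurableSet_le measurable_const (measurable_gauge 0)
  refine ((integrable_gauge_rpow hb one_pos).const_mul (4 ^ b)).mono'
    ((by fun_prop : Measurable fun p : Heis n => gauge 0 p ^ (-b)).indicator hs).aestronglyMeasurable
    (Eventually.of_forall fun p => ?_)
  by_cases hp : 1 ≤ gauge 0 p
  · have h0 : 0 < gauge 0 p := one_pos.trans_le hp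
    have h1 := gauge_pos one_pos p
    rw [indicator_of_mem (by exact hp), Real.norm_of_nonneg (by positivity),
      rpow_neg h0.le, rpow_neg h1.le, ← div_eq_mul_inv, le_div_iff₀ (by positivity), mul_comm,
      ← div_eq_mul_inv, div_le_iff₀ (by positivity), ← mul_rpow (by norm_num) h0.le]
    refine rpow_le_rpow h1.le ?_ (by linarith)
    unfold gauge at hp ⊢
    nlinarith [sq_nonneg ((‖p.1‖ ^ 2 + ‖p.2.1‖ ^ 2) - 1), sq_nonneg p.2.2]
  · rw [indicator_of_notMem (by exact hp), norm_zero]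
    have := gauge_pos one_pos p
    positivity

/-- The product of the singular kernel with a truncated homogeneous norm. -/
def truncKernel (n : ℕ) (s : ℝ) (p : Heis n) : ℝ :=
  min 1 (gauge 0 p ^ (1 / 4 : ℝ)) * gauge 0 p ^ (-(((n : ℝ) + 1 + s) / 2))

@[fun_prop]
lemma measurable_truncKernel (s : ℝ) : Measurable (truncKernel n s) := by
  unfold truncKernel
  fun_prop

lemma truncKernel_nonneg (s : ℝ) (p : Heis n) : 0 ≤ truncKernel n s p := by
  have := gauge_nonneg 0 p
  unfold truncKernel
  positivity

lemma integrable_truncKernel (hn : 1 ≤ n) {s : ℝ} (hs : 0 < s) (hs1 : s < 1 / 2) :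
    Integrable (truncKernel n s) := by
  have hm1 : MeasurableSet {p : Heis n | 1 ≤ gauge 0 p} :=
    measurableSet_le measurable_const (measurable_gauge 0)
  have hm2 : MeasurableSet {p : Heis n | gauge 0 p ≤ 1} :=
    measurableSet_le (measurable_gauge 0) measurable_const
  have h1 := integrable_indicator_gauge (n := n) (((n : ℝ) + 1 + s) / 2) (by linarith)
  have h2 : Integrable ({p : Heis n | gauge 0 p ≤ 1}.indicator fun p =>
      gauge 0 p ^ (1 / 4 - ((n : ℝ) + 1 + s) / 2)) := by
    rw [← integrable_comp_kinv_iff hn (Measurable.indicator (by fun_prop) hm2)]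
    refine (integrable_indicator_gauge (n := n) ((n : ℝ) + 1 + 1 / 4 - ((n : ℝ) + 1 + s) / 2)
      (by linarith)).congr ?_
    filter_upwards [gauge_zero_ne_zero hn] with p hp
    have hk := gauge_zero_kinv hp
    by_cases h : 1 ≤ gauge 0 p
    · rw [indicator_of_mem (by exact h), indicator_of_mem
        (by simpa [hk] using inv_le_one_of_one_le₀ h), hk, inv_rpow hp.le, ← rpow_neg hp.le,
        ← rpow_natCast, ← rpow_neg hp.le, ← rpow_add hp]
      congr 1
      push_cast
      ring
    · rw [indicator_of_notMem (by exact h), indicator_of_notMem, mul_zero]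
      simp only [mem_ofPred_eq, hk, not_le]
      exact (one_lt_inv₀ hp).mpr (not_le.mp h)
  refine (h1.add h2).mono' (measurable_truncKernel s).aestronglyMeasurable ?_
  filter_upwards [gauge_zero_ne_zero hn] with p hp
  rw [Real.norm_of_nonneg (truncKernel_nonneg s p), truncKernel]
  rcases le_total 1 (gauge 0 p) with h | h
  · rw [Pi.add_apply, indicator_of_mem (by exact h)]
    refine le_add_of_le_of_nonneg ?_ (indicator_nonneg (fun q _ => rpow_nonneg (gauge_nonneg _ _) _) _)
    exact mul_le_of_le_one_left (by positivity) (min_le_left _ _)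
  · rw [Pi.add_apply, indicator_of_mem (s := {p : Heis n | gauge 0 p ≤ 1}) (by exact h)]
    refine le_add_of_nonneg_of_le (indicator_nonneg (fun q _ => rpow_nonneg (gauge_nonneg _ _) _) _) ?_
    rw [sub_eq_add_neg, rpow_add hp]
    gcongr
    exact min_le_right _ _

lemma norm_hmul_sub_le {R : ℝ} {p h : Heis n} (hp : ‖p‖ ≤ R) (hh : gauge 0 h ≤ 1) :
    ‖hmul p h - p‖ ≤ (1 + R) * gauge 0 h ^ (1 / 4 : ℝ) := by
  have hR : 0 ≤ R := (norm_nonneg p).trans hp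
  have hg := gauge_nonneg 0 h
  set d := gauge 0 h ^ (1 / 4 : ℝ) with hd
  have hd0 : 0 ≤ d := by positivity
  have hd4 : d ^ 4 = gauge 0 h := by
    rw [hd, ← rpow_natCast, ← rpow_mul hg]; norm_num
  have hd1 : d ≤ 1 := rpow_le_one hg hh (by norm_num)
  have hgd : (0 + (‖h.1‖ ^ 2 + ‖h.2.1‖ ^ 2)) ^ 2 + 16 * h.2.2 ^ 2 = d ^ 4 := hd4.symm
  have h1 : ‖h.1‖ ^ 2 + ‖h.2.1‖ ^ 2 ≤ d ^ 2 := by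
    refine le_of_sq_le_sq ?_ (by positivity)
    nlinarith [sq_nonneg h.2.2]
  have hx : ‖h.1‖ ≤ d := le_of_sq_le_sq (by nlinarith [sq_nonneg ‖h.2.1‖]) hd0
  have hy : ‖h.2.1‖ ≤ d := le_of_sq_le_sq (by nlinarith [sq_nonneg ‖h.1‖]) hd0
  have ht : |h.2.2| ≤ d ^ 2 / 4 := by
    refine abs_le_of_sq_le_sq ?_ (by positivity)
    nlinarith [sq_nonneg (0 + (‖h.1‖ ^ 2 + ‖h.2.1‖ ^ 2))]
  have hp1 : ‖p.1‖ ≤ R := (norm_fst_le p).trans hp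
  have hp2 : ‖p.2.1‖ ≤ R := (norm_fst_le p.2).trans ((norm_snd_le p).trans hp)
  have e : hmul p h - p = (h.1, h.2.1, h.2.2 + 1 / 2 * (⟪p.2.1, h.1⟫ - ⟪p.1, h.2.1⟫)) := by
    rw [hmul_eq]
    refine Prod.ext (by simp) (Prod.ext (by simp) ?_)
    simp only [Prod.snd_sub]
    ring
  have hdR : d ≤ (1 + R) * d := by nlinarith
  rw [e]
  refine max_le (hx.trans hdR) (max_le (hy.trans hdR) ?_)
  have i1 : |⟪p.2.1, h.1⟫| ≤ R * d := (abs_real_inner_le_norm _ _).trans (by gcongr)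
  have i2 : |⟪p.1, h.2.1⟫| ≤ R * d := (abs_real_inner_le_norm _ _).trans (by gcongr)
  rw [Real.norm_eq_abs]
  rw [abs_le] at i1 i2 ht ⊢
  constructor <;> nlinarith

lemma exists_abs_sub_hmul_le {F : Heis n → ℝ} (hF : ContDiff ℝ 1 F) {B : ℝ}
    (hB : ∀ p, |F p| ≤ B) {P : Set (Heis n)} (hP : IsCompact P) :
    ∃ C : ℝ, 0 ≤ C ∧ ∀ p ∈ P, ∀ h, |F (hmul p h) - F p| ≤ C * min 1 (gauge 0 h ^ (1 / 4 : ℝ)) := by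
  obtain ⟨R, hR0, hR⟩ := hP.isBounded.exists_pos_norm_le
  obtain ⟨L, hL⟩ := hF.contDiffOn.exists_lipschitzOnWith one_ne_zero
    (convex_closedBall (0 : Heis n) (2 * R + 1)) (isCompact_closedBall _ _)
  have hB0 : 0 ≤ B := (abs_nonneg _).trans (hB 0)
  refine ⟨max (2 * B) (L * (1 + R)), by positivity, fun p hp h => ?_⟩
  have hg := gauge_nonneg 0 h
  rcases le_total 1 (gauge 0 h) with h1 | h1
  · rw [min_eq_left (one_le_rpow h1 (by norm_num)), mul_one]
    refine le_max_of_le_left ?_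
    have := abs_sub (F (hmul p h)) (F p)
    linarith [hB (hmul p h), hB p]
  · have hd1 : gauge 0 h ^ (1 / 4 : ℝ) ≤ 1 := rpow_le_one hg h1 (by norm_num)
    rw [min_eq_right hd1]
    have hn := norm_hmul_sub_le (hR p hp) h1
    have hp' : p ∈ Metric.closedBall (0 : Heis n) (2 * R + 1) := by
      rw [mem_closedBall_zero_iff]; linarith [hR p hp]
    have hq : hmul p h ∈ Metric.closedBall (0 : Heis n) (2 * R + 1) := by
      rw [mem_closedBall_zero_iff]
      have h2 := norm_add_le (hmul p h - p) p
      rw [sub_add_cancel] at h2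
      nlinarith [hR p hp]
    have := hL.norm_sub_le hq hp'
    rw [Real.norm_eq_abs] at this
    calc _ ≤ L * ‖hmul p h - p‖ := this
      _ ≤ L * ((1 + R) * gauge 0 h ^ (1 / 4 : ℝ)) := by gcongr
      _ = (L * (1 + R)) * gauge 0 h ^ (1 / 4 : ℝ) := by ring
      _ ≤ _ := by gcongr; exact le_max_right _ _

lemma integrable_indicator_mul_truncKernel (hn : 1 ≤ n) {s : ℝ} (hs : 0 < s) (hs1 : s < 1 / 2)
    {P : Set (Heis n)} (hP : IsCompact P) :
    Integrable (fun z : Heis n × Heis n =>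
      P.indicator (fun _ => (1 : ℝ)) z.1 * truncKernel n s (hmul (hinv z.1) z.2))
      (volume.prod volume) := by
  have h1 : Integrable (P.indicator fun _ => (1 : ℝ)) (volume : Measure (Heis n)) :=
    (integrable_indicator_iff hP.measurableSet).mpr
      (integrableOn_const hP.measure_lt_top.ne)
  exact measurePreserving_prod_hmul.integrable_comp_of_integrable
    (h1.mul_prod (integrable_truncKernel hn hs hs1))

/-- The weight `gauge c ^ (-(n + 1 - s) / 2)`. -/
def weight (n : ℕ) (s c : ℝ) (p : Heis n) : ℝ := gauge c p ^ (-(((n : ℝ) + 1 - s) / 2))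

lemma weight_pos {s c : ℝ} (hc : 0 < c) (p : Heis n) : 0 < weight n s c p :=
  rpow_pos_of_pos (gauge_pos hc p) _

@[fun_prop]
lemma measurable_weight (s c : ℝ) : Measurable (weight n s c) := by unfold weight; fun_prop

lemma contDiff_weight {s c : ℝ} (hc : 0 < c) : ContDiff ℝ 1 (weight n s c) := by
  refine ContDiff.rpow_const_of_ne ?_ fun p => (gauge_pos hc p).ne'
  unfold gauge
  have h1 : ContDiff ℝ 1 fun p : Heis n => ‖p.1‖ ^ 2 := contDiff_fst.norm_sq ℝ
  have h2 : ContDiff ℝ 1 fun p : Heis n => ‖p.2.1‖ ^ 2 :=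
    (contDiff_fst.comp contDiff_snd).norm_sq ℝ
  fun_prop

lemma abs_weight_le {s c : ℝ} (hc : 0 < c) (hs : s < 1) (p : Heis n) :
    |weight n s c p| ≤ (c ^ 2) ^ (-(((n : ℝ) + 1 - s) / 2)) := by
  have hn0 : (0 : ℝ) ≤ n := by positivity
  rw [abs_of_pos (weight_pos hc p)]
  refine rpow_le_rpow_of_nonpos (by positivity) ?_ (by linarith)
  unfold gauge
  nlinarith [sq_nonneg ‖p.1‖, sq_nonneg ‖p.2.1‖, sq_nonneg p.2.2,
    sq_nonneg (‖p.1‖ ^ 2 + ‖p.2.1‖ ^ 2)]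

end Domination

section GroundState

variable {n : ℕ}

/-- The kernel `gauge 0 ^ (-(n + 1 + s) / 2)`. -/
def kernel (n : ℕ) (s : ℝ) (p : Heis n) : ℝ := gauge 0 p ^ (-(((n : ℝ) + 1 + s) / 2))

lemma kernel_nonneg (s : ℝ) (p : Heis n) : 0 ≤ kernel n s p := rpow_nonneg (gauge_nonneg _ _) _

@[fun_prop]
lemma measurable_kernel (s : ℝ) : Measurable (kernel n s) := by unfold kernel; fun_prop

lemma truncKernel_eq (s : ℝ) (p : Heis n) :
    truncKernel n s p = min 1 (gauge 0 p ^ (1 / 4 : ℝ)) * kernel n s p := rfl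

lemma kernel_hinv_hmul_comm (s : ℝ) (p q : Heis n) :
    kernel n s (hmul (hinv q) p) = kernel n s (hmul (hinv p) q) := by
  rw [kernel, gauge_hinv_hmul_comm, kernel]

lemma abs_weight_sub_mul_kernel_le {s c : ℝ} (hc : 0 < c) (hs : s < 1)
    {P : Set (Heis n)} (hP : IsCompact P) :
    ∃ C : ℝ, 0 ≤ C ∧ ∀ p ∈ P, ∀ h,
      |(weight n s c p - weight n s c (hmul p h)) * kernel n s h| ≤ C * truncKernel n s h := by
  obtain ⟨C, hC0, hC⟩ := exists_abs_sub_hmul_le (contDiff_weight hc) (abs_weight_le hc hs) hP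
  refine ⟨C, hC0, fun p hp h => ?_⟩
  rw [abs_mul, abs_of_nonneg (kernel_nonneg s h), truncKernel_eq, ← mul_assoc, abs_sub_comm]
  exact mul_le_mul_of_nonneg_right (hC p hp h) (kernel_nonneg s h)

lemma integrable_weight_sub_mul_kernel (hn : 1 ≤ n) {s c : ℝ} (hs : 0 < s) (hs1 : s < 1 / 2)
    (hc : 0 < c) (p : Heis n) :
    Integrable fun g => (weight n s c p - weight n s c (hmul p g)) * kernel n s g := by
  obtain ⟨C, -, hC⟩ := abs_weight_sub_mul_kernel_le (n := n) (s := s) hc (by linarith)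
    (isCompact_singleton (x := p))
  have hm := (continuous_hmul_left p).measurable
  exact ((integrable_truncKernel hn hs hs1).const_mul C).mono'
    (by fun_prop : Measurable _).aestronglyMeasurable (Eventually.of_forall fun g => hC p rfl g)

lemma weight_sub_mul_kernel_kinv {s c : ℝ} (hc : 0 < c) (p : Heis n) {g : Heis n}
    (hg : 0 < gauge 0 g) :
    ((gauge 0 g) ^ (n + 1))⁻¹ *
        ((weight n s c p - weight n s c (hmul p (kinv g))) * kernel n s (kinv g))
      = weight n s c p *
        (weight n s 0 g - weight n s (c / gauge c p) (hmul (siegelInv c p) g)) := by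
  have hM := gauge_pos hc p
  have hD := gauge_pos (div_pos hc hM) (hmul (siegelInv c p) g)
  have h1 : ((gauge 0 g) ^ (n + 1))⁻¹ * kernel n s (kinv g) = weight n s 0 g := by
    rw [kernel, weight, gauge_zero_kinv hg, inv_rpow hg.le, ← rpow_neg hg.le, ← rpow_natCast,
      ← rpow_neg hg.le, ← rpow_add hg]
    congr 1
    push_cast
    ring
  have h2 : weight n s c (hmul p (kinv g)) = weight n s c p * (weight n s 0 g)⁻¹ *
      weight n s (c / gauge c p) (hmul (siegelInv c p) g) := by
    simp only [weight]
    rw [gauge_hmul_kinv hc p hg, mul_rpow (by positivity) hD.le, div_rpow hM.le hg.le,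
      div_eq_mul_inv]
  have h3 : 0 < weight n s 0 g := rpow_pos_of_pos hg _
  calc _ = (weight n s c p - weight n s c (hmul p (kinv g))) *
        (((gauge 0 g) ^ (n + 1))⁻¹ * kernel n s (kinv g)) := by ring
    _ = _ := by
      rw [h1, h2]
      field_simp

lemma integrable_weight_sub_aux (hn : 1 ≤ n) {s c : ℝ} (hs : 0 < s) (hs1 : s < 1 / 2)
    (hc : 0 < c) (p : Heis n) :
    Integrable fun g => weight n s 0 g - weight n s (c / gauge c p) (hmul (siegelInv c p) g) := by
  have hm := (continuous_hmul_left p).measurable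
  have h := (integrable_comp_kinv_iff hn (F := fun g =>
    (weight n s c p - weight n s c (hmul p g)) * kernel n s g) (by fun_prop)).mpr
    (integrable_weight_sub_mul_kernel hn hs hs1 hc p)
  have hw := weight_pos (n := n) (s := s) hc p
  rw [← integrable_const_mul_iff (isUnit_iff_ne_zero.mpr hw.ne')]
  refine h.congr ?_
  filter_upwards [gauge_zero_ne_zero hn] with g hg
  exact weight_sub_mul_kernel_kinv hc p hg

lemma integrable_weight_zero_sub (hn : 1 ≤ n) {s c : ℝ} (hs : 0 < s) (hs1 : s < 1 / 2)
    (hc : 0 < c) (p : Heis n) :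
    Integrable fun g => weight n s 0 g - weight n s c (hmul p g) := by
  have hM := gauge_pos hc p
  have h := integrable_weight_sub_aux hn hs hs1 (div_pos hc hM) (siegelInv c p)
  rw [siegelInv_siegelInv hc, gauge_siegelInv hc] at h
  rwa [show c / gauge c p / (gauge c p)⁻¹ = c by field_simp] at h

lemma integral_weight_sub_mul_kernel (hn : 1 ≤ n) {s c : ℝ} (hc : 0 < c) (p : Heis n) :
    ∫ g, (weight n s c p - weight n s c (hmul p g)) * kernel n s g
      = weight n s c p *
        ∫ g, (weight n s 0 g - weight n s (c / gauge c p) (hmul (siegelInv c p) g)) := by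
  have hm := (continuous_hmul_left p).measurable
  rw [← integral_comp_kinv hn (F := fun g =>
    (weight n s c p - weight n s c (hmul p g)) * kernel n s g) (by fun_prop), ← integral_const_mul]
  refine integral_congr_ae ?_
  filter_upwards [gauge_zero_ne_zero hn] with g hg
  exact weight_sub_mul_kernel_kinv hc p hg

/-- The integral of the difference of the weight and its left translate. -/
def shiftDefect (n : ℕ) (s c : ℝ) (p : Heis n) : ℝ :=
  ∫ g, (weight n s c g - weight n s c (hmul p g))

lemma zero_hmul (g : Heis n) : hmul 0 g = g := by
  rw [hmul_eq]
  simp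

lemma integrable_weight_sub_shift (hn : 1 ≤ n) {s c : ℝ} (hs : 0 < s) (hs1 : s < 1 / 2)
    (hc : 0 < c) (p : Heis n) :
    Integrable fun g => weight n s c g - weight n s c (hmul p g) := by
  refine ((integrable_weight_zero_sub hn hs hs1 hc p).sub
    (integrable_weight_zero_sub hn hs hs1 hc 0)).congr (Eventually.of_forall fun g => ?_)
  simp only [Pi.sub_apply, zero_hmul]
  ring

lemma shiftDefect_hmul (hn : 1 ≤ n) {s c : ℝ} (hs : 0 < s) (hs1 : s < 1 / 2)
    (hc : 0 < c) (p q : Heis n) :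
    shiftDefect n s c (hmul p q) = shiftDefect n s c p + shiftDefect n s c q := by
  have h1 := integrable_weight_sub_shift hn hs hs1 hc p
  have h2 := integrable_weight_sub_shift hn hs hs1 hc q
  have h3 : Integrable fun g => weight n s c (hmul q g) - weight n s c (hmul p (hmul q g)) :=
    (measurePreserving_hmul_left q).integrable_comp_of_integrable h1
  have h4 := (measurePreserving_hmul_left q).integral_comp (measurableEmbedding_hmul_left q)
    (fun g => weight n s c g - weight n s c (hmul p g))
  simp only [shiftDefect]
  rw [← h4, ← integral_add h3 h2]
  refine integral_congr_ae (Eventually.of_forall fun g => ?_)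
  simp only [hmul_assoc]
  ring

lemma shiftDefect_signAut {ε η : ℝ} (hε : ε ^ 2 = 1) (hη : η ^ 2 = 1) (s c : ℝ) (p : Heis n) :
    shiftDefect n s c (signAut ε η p) = shiftDefect n s c p := by
  simp only [shiftDefect]
  rw [← (measurePreserving_signAut hε hη).integral_comp (measurableEmbedding_signAut hε hη)]
  refine integral_congr_ae (Eventually.of_forall fun g => ?_)
  simp only [weight, ← signAut_hmul, gauge_signAut hε hη]

lemma shiftDefect_eq_zero_of_signAut (hn : 1 ≤ n) {s c : ℝ} (hs : 0 < s) (hs1 : s < 1 / 2)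
    (hc : 0 < c) {ε η : ℝ} (hε : ε ^ 2 = 1) (hη : η ^ 2 = 1) {p : Heis n}
    (hp : hmul p (signAut ε η p) = 0) : shiftDefect n s c p = 0 := by
  have h := shiftDefect_hmul hn hs hs1 hc p (signAut ε η p)
  have h0 : shiftDefect n s c (0 : Heis n) = 0 := by simp [shiftDefect, zero_hmul]
  rw [shiftDefect_signAut hε hη, hp, h0] at h
  linarith

lemma shiftDefect_eq_zero (hn : 1 ≤ n) {s c : ℝ} (hs : 0 < s) (hs1 : s < 1 / 2)
    (hc : 0 < c) (p : Heis n) : shiftDefect n s c p = 0 := by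
  have h : p = hmul (p.1, p.2.1, 0) (0, 0, p.2.2) := by rw [hmul_eq]; simp
  rw [h, shiftDefect_hmul hn hs hs1 hc,
    shiftDefect_eq_zero_of_signAut hn hs hs1 hc (ε := -1) (η := -1) (by norm_num) (by norm_num),
    shiftDefect_eq_zero_of_signAut hn hs hs1 hc (ε := 1) (η := -1) (by norm_num) (by norm_num),
    add_zero]
  · rw [hmul_eq]
    simp [signAut]
  · rw [hmul_eq]
    simp [signAut, real_inner_comm p.1 p.2.1]

lemma integral_weight_zero_sub (hn : 1 ≤ n) {s c : ℝ} (hs : 0 < s) (hs1 : s < 1 / 2)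
    (hc : 0 < c) (p : Heis n) :
    ∫ g, (weight n s 0 g - weight n s c (hmul p g)) = defectConst n s * c ^ s := by
  have h1 := integrable_weight_sub_shift hn hs hs1 hc p
  have h2 : Integrable fun g : Heis n => weight n s 0 g - weight n s c g :=
    integrable_defect hn hs (by linarith) hc.le
  have h3 : ∫ g : Heis n, (weight n s 0 g - weight n s c g) = defectConst n s * c ^ s :=
    integral_defect hn hs (by linarith) hc.le
  have h4 := integral_add h2 h1
  rw [h3, show ∫ g, (weight n s c g - weight n s c (hmul p g)) = 0 from
    shiftDefect_eq_zero hn hs hs1 hc p, add_zero] at h4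
  rw [← h4]
  simp

lemma integral_weight_sub_mul_kernel_eq (hn : 1 ≤ n) {s c : ℝ} (hs : 0 < s) (hs1 : s < 1 / 2)
    (hc : 0 < c) (p : Heis n) :
    ∫ g, (weight n s c p - weight n s c (hmul p g)) * kernel n s g
      = defectConst n s * c ^ s * weight n s c p * gauge c p ^ (-s) := by
  have hM := gauge_pos hc p
  rw [integral_weight_sub_mul_kernel hn hc, integral_weight_zero_sub hn hs hs1 (div_pos hc hM),
    div_rpow hc.le hM.le, rpow_neg hM.le]
  ring

lemma mul_sub_div_le_sq_sub {a b : ℝ} (ha : 0 < a) (hb : 0 < b) (x y : ℝ) :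
    (a - b) * (x ^ 2 / a - y ^ 2 / b) ≤ (x - y) ^ 2 := by
  have h : (x - y) ^ 2 - (a - b) * (x ^ 2 / a - y ^ 2 / b) = (b * x - a * y) ^ 2 / (a * b) := by
    field_simp
    ring
  have : 0 ≤ (b * x - a * y) ^ 2 / (a * b) := by positivity
  linarith

lemma integrable_sq_sub_mul_kernel (hn : 1 ≤ n) {s : ℝ} (hs : 0 < s) (hs1 : s < 1 / 2)
    {f : Heis n → ℝ} (hf : ContDiff ℝ 1 f) (hfc : HasCompactSupport f) :
    Integrable (fun z : Heis n × Heis n => (f z.1 - f z.2) ^ 2 * kernel n s (hmul (hinv z.1) z.2))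
      (volume.prod volume) := by
  have hm := hf.continuous.measurable
  have hmm : Measurable fun z : Heis n × Heis n => hmul (hinv z.1) z.2 :=
    (continuous_hmul.comp (by fun_prop : Continuous fun z : Heis n × Heis n =>
      (hinv z.1, z.2))).measurable
  obtain ⟨B, hB⟩ := hf.continuous.bounded_above_of_compact_support hfc
  obtain ⟨C, hC0, hC⟩ := exists_abs_sub_hmul_le hf hB hfc.isCompact
  have h1 := (integrable_indicator_mul_truncKernel hn hs hs1 hfc.isCompact)
  have hbound : ∀ p q, p ∈ tsupport f → (f p - f q) ^ 2 * kernel n s (hmul (hinv p) q)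
      ≤ C ^ 2 * ((tsupport f).indicator (fun _ => (1 : ℝ)) p * truncKernel n s (hmul (hinv p) q)) := by
    intro p q hp
    rw [indicator_of_mem hp, one_mul, truncKernel_eq, ← mul_assoc]
    refine mul_le_mul_of_nonneg_right ?_ (kernel_nonneg _ _)
    have h := hC p hp (hmul (hinv p) q)
    rw [hmul_hinv_cancel] at h
    have hg := gauge_nonneg 0 (hmul (hinv p) q)
    set r := min 1 (gauge 0 (hmul (hinv p) q) ^ (1 / 4 : ℝ)) with hr
    have hr0 : 0 ≤ r := by positivity
    have hr1 : r ≤ 1 := min_le_left _ _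
    calc (f p - f q) ^ 2 = |f q - f p| ^ 2 := by rw [sq_abs]; ring
      _ ≤ (C * r) ^ 2 := by gcongr
      _ = C ^ 2 * (r * r) := by ring
      _ ≤ C ^ 2 * (r * 1) := by gcongr
      _ = _ := by ring
  have hpos : ∀ p q, 0 ≤ C ^ 2 * ((tsupport f).indicator (fun _ => (1 : ℝ)) p *
      truncKernel n s (hmul (hinv p) q)) := fun p q =>
    mul_nonneg (sq_nonneg _) (mul_nonneg (indicator_nonneg (fun _ _ => zero_le_one) _)
      (truncKernel_nonneg _ _))
  refine ((h1.const_mul (C ^ 2)).add (h1.const_mul (C ^ 2)).swap).mono'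
    (by fun_prop : Measurable _).aestronglyMeasurable (Eventually.of_forall fun z => ?_)
  rw [Real.norm_of_nonneg (mul_nonneg (sq_nonneg _) (kernel_nonneg _ _))]
  simp only [Pi.add_apply, Function.comp, Prod.fst_swap, Prod.snd_swap]
  by_cases hz1 : z.1 ∈ tsupport f
  · exact le_add_of_le_of_nonneg (hbound _ _ hz1) (hpos _ _)
  by_cases hz2 : z.2 ∈ tsupport f
  · refine le_add_of_nonneg_of_le (hpos _ _) ?_
    rw [← kernel_hinv_hmul_comm, ← neg_sq, neg_sub]
    exact hbound _ _ hz2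
  · rw [image_eq_zero_of_notMem_tsupport hz1, image_eq_zero_of_notMem_tsupport hz2]
    simpa using add_nonneg (hpos z.1 z.2) (hpos z.2 z.1)

lemma integrable_mul_weight_sub_mul_kernel (hn : 1 ≤ n) {s c : ℝ} (hs : 0 < s) (hs1 : s < 1 / 2)
    (hc : 0 < c) {h : Heis n → ℝ} (hh : Continuous h) (hhc : HasCompactSupport h) :
    Integrable (fun z : Heis n × Heis n => h z.1 *
      ((weight n s c z.1 - weight n s c z.2) * kernel n s (hmul (hinv z.1) z.2)))
      (volume.prod volume) := by
  have hm := hh.measurable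
  have hmm : Measurable fun z : Heis n × Heis n => hmul (hinv z.1) z.2 :=
    (continuous_hmul.comp (by fun_prop : Continuous fun z : Heis n × Heis n =>
      (hinv z.1, z.2))).measurable
  obtain ⟨B, hB⟩ := hh.bounded_above_of_compact_support hhc
  obtain ⟨C, hC0, hC⟩ := abs_weight_sub_mul_kernel_le (n := n) (s := s) hc (by linarith)
    hhc.isCompact
  have hB0 : 0 ≤ B := (norm_nonneg _).trans (hB 0)
  refine ((integrable_indicator_mul_truncKernel hn hs hs1 hhc.isCompact).const_mul (B * C)).mono'
    (by fun_prop : Measurable _).aestronglyMeasurable (Eventually.of_forall fun z => ?_)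
  by_cases hz : z.1 ∈ tsupport h
  · have h1 := hC z.1 hz (hmul (hinv z.1) z.2)
    rw [hmul_hinv_cancel] at h1
    rw [indicator_of_mem hz, one_mul, norm_mul, mul_assoc]
    exact mul_le_mul (hB _) h1 (norm_nonneg _) hB0
  · rw [image_eq_zero_of_notMem_tsupport hz, indicator_of_notMem hz]
    simp

lemma integral_mul_weight_sub_mul_kernel (hn : 1 ≤ n) {s c : ℝ} (hs : 0 < s) (hs1 : s < 1 / 2)
    (hc : 0 < c) (p : Heis n) :
    ∫ q, (weight n s c p - weight n s c q) * kernel n s (hmul (hinv p) q)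
      = defectConst n s * c ^ s * weight n s c p * gauge c p ^ (-s) := by
  rw [← integral_weight_sub_mul_kernel_eq hn hs hs1 hc,
    ← (measurePreserving_hmul_left p).integral_comp (measurableEmbedding_hmul_left p)]
  simp only [hinv_hmul_cancel]

lemma integral_sq_sub_mul_kernel_ge (hn : 1 ≤ n) {s c : ℝ} (hs : 0 < s) (hs1 : s < 1 / 2)
    (hc : 0 < c) {f : Heis n → ℝ} (hf : ContDiff ℝ 1 f) (hfc : HasCompactSupport f) :
    2 * (defectConst n s * c ^ s * ∫ p, f p ^ 2 * gauge c p ^ (-s))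
      ≤ ∫ p, ∫ q, (f p - f q) ^ 2 * kernel n s (hmul (hinv p) q) := by
  set w := weight n s c with hw
  have hwpos : ∀ p, 0 < w p := weight_pos hc
  set h : Heis n → ℝ := fun p => f p ^ 2 / w p with hh
  have hhcont : Continuous h :=
    (hf.continuous.pow 2).div (contDiff_weight hc).continuous fun p => (hwpos p).ne'
  have hhc : HasCompactSupport h := by
    refine hfc.mono fun p hp => ?_
    rw [Function.mem_support] at hp ⊢
    contrapose! hp
    simp [hh, hp]
  have hG := integrable_sq_sub_mul_kernel hn hs hs1 hf hfc
  have hR := integrable_mul_weight_sub_mul_kernel hn hs hs1 hc hhcont hhc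
  have hle := integral_mono (hR.add hR.swap) hG fun z => by
    simp only [Pi.add_apply, Function.comp, Prod.fst_swap, Prod.snd_swap]
    rw [kernel_hinv_hmul_comm s z.1 z.2]
    have := mul_le_mul_of_nonneg_right (mul_sub_div_le_sq_sub (hwpos z.1) (hwpos z.2) (f z.1) (f z.2))
      (kernel_nonneg s (hmul (hinv z.1) z.2))
    refine le_trans (le_of_eq ?_) this
    simp only [hh, hw]
    ring
  rw [integral_add' hR hR.swap, integral_prod _ hG] at hle
  refine le_trans (le_of_eq ?_) hle
  have hsw := integral_prod_swap (μ := (volume : Measure (Heis n))) (ν := (volume : Measure (Heis n)))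
    (fun z : Heis n × Heis n => h z.1 *
      ((weight n s c z.1 - weight n s c z.2) * kernel n s (hmul (hinv z.1) z.2)))
  rw [show ∀ a b : ℝ, b = a → a + b = 2 * a from fun a b hab => by rw [hab]; ring]
  swap
  · exact hsw
  rw [integral_prod _ hR, ← integral_const_mul]
  congr 1
  refine integral_congr_ae (Eventually.of_forall fun p => ?_)
  simp only
  rw [integral_const_mul, integral_mul_weight_sub_mul_kernel hn hs hs1 hc]
  have := hwpos p
  simp only [hh]
  rw [← hw]
  field_simp

end GroundState

end Heis

theorem stmt_15 (n : ℕ) (hn : 1 ≤ n) (s δ : ℝ) (hs0 : 0 < s) (hs1 : s < 1 / 2)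
    (hδ : 0 < δ) (f : Heis n → ℝ)
    (hf : ContDiff ℝ (⊤ : ℕ∞) f) (hfc : HasCompactSupport f) :
    (4 : ℝ) ^ (1 + s) * s / π ^ ((n : ℝ) + 1 / 2) *
        (Gamma ((n : ℝ) + s) * Gamma (((n : ℝ) + 1 + s) / 2)) /
        (Gamma (((n : ℝ) + s) / 2) * Gamma (1 - s)) / 2 *
      (∫ p : Heis n, ∫ q : Heis n,
        (f p - f q) ^ 2 * hnorm (hmul (hinv q) p) ^ (-(2 * (n : ℝ) + 2 + 2 * s))) ≥
    (4 : ℝ) ^ (2 * s) *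
        (Gamma (((n : ℝ) + 1 + s) / 2) / Gamma (((n : ℝ) + 1 - s) / 2)) ^ 2 *
        δ ^ (2 * s) *
      ∫ p : Heis n, f p ^ 2 *
        ((δ ^ 2 + (‖p.1‖ ^ 2 + ‖p.2.1‖ ^ 2)) ^ 2 + 16 * p.2.2 ^ 2) ^ (-s) := by
  have hδ2 : 0 < δ ^ 2 := by positivity
  have key := integral_sq_sub_mul_kernel_ge hn hs0 hs1 hδ2 (hf.of_le (by exact_mod_cast le_top)) hfc
  have hconst := mul_defectConst (n := n) hs0 (by linarith)
  have hker : ∀ p q : Heis n, hnorm (hmul (hinv q) p) ^ (-(2 * (n : ℝ) + 2 + 2 * s))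
      = kernel n s (hmul (hinv p) q) := by
    intro p q
    have hg : hnorm (hmul (hinv q) p) = Heis.gauge 0 (hmul (hinv q) p) ^ (1 / 4 : ℝ) := by
      simp [hnorm, Heis.gauge]
    rw [hg, gauge_hinv_hmul_comm, ← rpow_mul (gauge_nonneg _ _), kernel]
    congr 1
    ring
  have hδs : (δ ^ 2) ^ s = δ ^ (2 * s) := by
    rw [← rpow_natCast, ← rpow_mul hδ.le, Nat.cast_ofNat]
  simp_rw [hker]
  set A : ℝ := (4 : ℝ) ^ (1 + s) * s / π ^ ((n : ℝ) + 1 / 2) *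
        (Gamma ((n : ℝ) + s) * Gamma (((n : ℝ) + 1 + s) / 2)) /
        (Gamma (((n : ℝ) + s) / 2) * Gamma (1 - s)) with hA
  have hA0 : 0 ≤ A := by
    have hn0 : (0 : ℝ) ≤ n := by positivity
    have h1 := Gamma_pos_of_pos (show 0 < (n : ℝ) + s by linarith)
    have h2 := Gamma_pos_of_pos (show 0 < ((n : ℝ) + 1 + s) / 2 by linarith)
    have h3 := Gamma_pos_of_pos (show 0 < ((n : ℝ) + s) / 2 by linarith)
    have h4 := Gamma_pos_of_pos (show 0 < 1 - s by linarith)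
    positivity
  rw [← hconst, ge_iff_le]
  refine le_trans (le_of_eq ?_) (mul_le_mul_of_nonneg_left key (by positivity : 0 ≤ A / 2))
  rw [hδs]
  simp only [Heis.gauge]
  ring
end
end
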